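/- arXiv:2501.05889 — 6 statements merged into one kernel-verified Lean document; each statement's English description precedes it below -/
import Mathlib

section
/- Let d ≥ 2 be an integer, ℓ ∈ ℕ₀, and let ζ ∈ ℂ^d satisfy ζ·ζ ≠ 0; write w := √(ζ·ζ) (principal square root). Then for every x ∈ S^{d−1}: (𝒫_ℓ e_ζ)(x) = Γ(d/2) · N_{ℓ,d} · (2/w)^{ν_d} · I_{ℓ+ν_d}(w) · P_{ℓ,d}(x·ζ / w), where I_ν(w) := ∑_{n=0}^∞ (1/(n! Γ(ν+n+1))) (w/2)^{ν+2n} is the modified Bessel function of the first kind (with principal complex powers). -/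
open MeasureTheory

noncomputable section

/-- Area of the unit sphere `S^{d-1}`: `2 π^{d/2} / Γ(d/2)`. -/
def sphereArea (d : ℕ) : ℝ := 2 * Real.pi ^ ((d : ℝ) / 2) / Real.Gamma ((d : ℝ) / 2)

/-- Dimension `N_{ℓ,d}` of the space of spherical harmonics of degree ℓ. -/
def Nld (d ℓ : ℕ) : ℕ :=
  (ℓ + d - 1).choose ℓ - if 2 ≤ ℓ then (ℓ + d - 3).choose (ℓ - 2) else 0

/-- Rodrigues-type right-hand side defining the generalized Legendre polynomial. -/
def legendreRHS (d ℓ : ℕ) (t : ℝ) : ℝ :=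
  (-1 : ℝ) ^ ℓ * (Real.Gamma (((d : ℝ) - 1) / 2) /
      (2 ^ ℓ * Real.Gamma ((ℓ : ℝ) + ((d : ℝ) - 1) / 2))) *
    (1 - t ^ 2) ^ (-(((d : ℝ) - 3) / 2)) *
    iteratedDeriv ℓ (fun s : ℝ => (1 - s ^ 2) ^ ((ℓ : ℝ) + ((d : ℝ) - 3) / 2)) t

/-- `P` is the generalized Legendre polynomial `P_{ℓ,d}`. -/
def IsLegendre (d ℓ : ℕ) (P : Polynomial ℂ) : Prop :=
  P.natDegree = ℓ ∧ ∀ t : ℝ, t ∈ Set.Ioo (-1 : ℝ) 1 →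
    P.eval (t : ℂ) = (legendreRHS d ℓ t : ℂ)

/-- The surface measure on the unit sphere of `ℝ^d`. -/
def sphMeasure (d : ℕ) :
    Measure (Metric.sphere (0 : EuclideanSpace ℝ (Fin d)) 1) :=
  (volume : Measure (EuclideanSpace ℝ (Fin d))).toSphere

open scoped RealInnerProductSpace in
/-- The projector `𝒫_ℓ` onto spherical harmonics of degree ℓ, expressed through the Legendre
polynomial `P` (to be taken equal to `P_{ℓ,d}`). -/
def projector (d ℓ : ℕ) (P : Polynomial ℂ)
    (f : Metric.sphere (0 : EuclideanSpace ℝ (Fin d)) 1 → ℂ)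
    (x : Metric.sphere (0 : EuclideanSpace ℝ (Fin d)) 1) : ℂ :=
  ((Nld d ℓ : ℂ) / (sphereArea d : ℂ)) *
    ∫ y, ((P.eval ((⟪(x : EuclideanSpace ℝ (Fin d)), (y : EuclideanSpace ℝ (Fin d))⟫ : ℝ) : ℂ)) *
      f y) ∂ sphMeasure d

/-- The exponential function `e_ζ(x) = exp(ζ · x)` restricted to the unit sphere. -/
def expFun (d : ℕ) (ζ : Fin d → ℂ)
    (y : Metric.sphere (0 : EuclideanSpace ℝ (Fin d)) 1) : ℂ :=
  Complex.exp (∑ i, ζ i * ((y : EuclideanSpace ℝ (Fin d)) i : ℂ))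

/-- Modified Bessel function of the first kind, with principal complex powers. -/
def besselI (ν w : ℂ) : ℂ :=
  ∑' n : ℕ, (1 / ((n.factorial : ℂ) * Complex.Gamma (ν + (n : ℂ) + 1))) *
    (w / 2) ^ (ν + 2 * (n : ℂ))

end

/-- The generalized Legendre polynomials through the three-term recurrence. -/
noncomputable def legPoly (d : ℕ) : ℕ → Polynomial ℂ
  | 0 => 1
  | 1 => Polynomial.X
  | (l + 2) => Polynomial.C ((2 * (l : ℂ) + d) / ((l : ℂ) + d - 1)) * Polynomial.X * legPoly d (l + 1)
      - Polynomial.C (((l : ℂ) + 1) / ((l : ℂ) + d - 1)) * legPoly d l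

/-- The homogenized version `w ^ l * P_l (u / w)` with `q = w ^ 2`. -/
noncomputable def legHom (d : ℕ) : ℕ → ℂ → ℂ → ℂ
  | 0 => fun _ _ => 1
  | 1 => fun u _ => u
  | (l + 2) => fun u q => ((2 * (l : ℂ) + d) / ((l : ℂ) + d - 1)) * u * legHom d (l + 1) u q
      - (((l : ℂ) + 1) / ((l : ℂ) + d - 1)) * q * legHom d l u q

lemma den_ne (d : ℕ) (hd : 2 ≤ d) (l : ℕ) : (l : ℂ) + d - 1 ≠ 0 := by
  obtain ⟨e, rfl⟩ := Nat.exists_eq_add_of_le hd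
  have : (l : ℂ) + ((2 + e : ℕ) : ℂ) - 1 = ((l + e + 1 : ℕ) : ℂ) := by push_cast; ring
  rw [this]
  exact Nat.cast_ne_zero.mpr (Nat.succ_ne_zero (l + e))

lemma legPoly_rec (d : ℕ) (hd : 2 ≤ d) (l : ℕ) (t : ℂ) :
    ((l : ℂ) + d - 1) * (legPoly d (l + 2)).eval t =
      (2 * (l : ℂ) + d) * t * (legPoly d (l + 1)).eval t - ((l : ℂ) + 1) * (legPoly d l).eval t := by
  have h := den_ne d hd l
  simp only [legPoly, Polynomial.eval_sub, Polynomial.eval_mul, Polynomial.eval_C, Polynomial.eval_X]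
  field_simp

lemma legHom_rec (d : ℕ) (hd : 2 ≤ d) (l : ℕ) (u q : ℂ) :
    ((l : ℂ) + d - 1) * legHom d (l + 2) u q =
      (2 * (l : ℂ) + d) * u * legHom d (l + 1) u q - ((l : ℂ) + 1) * q * legHom d l u q := by
  have h := den_ne d hd l
  simp only [legHom]
  field_simp

lemma legHom_eq (d : ℕ) (u w : ℂ) (hw : w ≠ 0) (l : ℕ) :
    w ^ l * (legPoly d l).eval (u / w) = legHom d l u (w ^ 2) := by
  induction l using Nat.twoStepInduction with
  | zero => simp [legPoly, legHom]
  | one => simp [legPoly, legHom]; field_simp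
  | more l h1 h2 =>
    simp only [legPoly, legHom, Polynomial.eval_sub, Polynomial.eval_mul, Polynomial.eval_C,
      Polynomial.eval_X]
    rw [← h1, ← h2]
    have e : w * (u / w) = u := by field_simp
    generalize (legPoly d l).eval (u / w) = A at *
    generalize (legPoly d (l+1)).eval (u / w) = B at *
    generalize (2 * (l : ℂ) + d) / ((l : ℂ) + d - 1) = c at *
    generalize ((l : ℂ) + 1) / ((l : ℂ) + d - 1) = c' at *
    linear_combination c * w ^ (l+1) * B * e

lemma legHom_hasDerivAt (d : ℕ) (hd : 2 ≤ d) (u q : ℂ) (l : ℕ) :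
    HasDerivAt (fun s : ℂ => legHom d l (u + s) (q + 2 * s * u + s ^ 2))
      (l * legHom d (l - 1) u q) 0 := by
  have hu : HasDerivAt (fun s : ℂ => u + s) 1 0 := (hasDerivAt_id (0:ℂ)).const_add u
  have hq : HasDerivAt (fun s : ℂ => q + 2 * s * u + s ^ 2) (2 * u) 0 := by
    have h1 : HasDerivAt (fun s : ℂ => 2 * s * u) (2 * 1 * u) 0 :=
      ((hasDerivAt_id (0:ℂ)).const_mul 2).mul_const u
    have h2 : HasDerivAt (fun s : ℂ => s ^ 2) _ 0 := hasDerivAt_pow 2 (0:ℂ)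
    refine HasDerivAt.congr_deriv ((h1.const_add q).add h2) ?_
    simp
  induction l using Nat.twoStepInduction with
  | zero => simpa [legHom] using hasDerivAt_const (0:ℂ) (1:ℂ)
  | one => simpa [legHom] using hu
  | more l h1 h2 =>
    have h := ((hu.const_mul ((2 * (l : ℂ) + d) / ((l : ℂ) + d - 1))).mul h2).sub
      ((hq.const_mul (((l : ℂ) + 1) / ((l : ℂ) + d - 1))).mul h1)
    refine HasDerivAt.congr_deriv h ?_
    have hne := den_ne d hd l
    simp only [add_zero, mul_zero, zero_mul, ne_eq, OfNat.ofNat_ne_zero, not_false_eq_true, zero_pow]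
    rcases l with _ | l
    · simp [legHom] at hne ⊢
      field_simp
      ring
    · have r := legHom_rec d hd l u q
      have hne' := den_ne d hd l
      have e1 : l + 1 + 2 - 1 = l + 2 := by omega
      have e2 : l + 1 + 1 - 1 = l + 1 := by omega
      have e3 : l + 1 - 1 = l := by omega
      rw [e1, e2, e3]
      have e4 : l + 1 + 1 = l + 2 := rfl
      rw [e4] at *
      push_cast at *
      generalize legHom d (l + 2) u q = A at *
      generalize legHom d (l + 1) u q = B at *
      generalize legHom d l u q = C at *
      field_simp
      linear_combination (-(l:ℂ) - 2) * r

lemma legPoly_shift (d : ℕ) (hd : 2 ≤ d) (t : ℂ) (l : ℕ) :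
    ((l : ℂ) + 1) * (1 - t ^ 2) * (legPoly (d + 2) l).eval t =
      ((d : ℂ) - 1) * (t * (legPoly d (l + 1)).eval t - (legPoly d (l + 2)).eval t) := by
  induction l using Nat.twoStepInduction with
  | zero =>
    have hne := den_ne d hd 0
    have r := legPoly_rec d hd 0 t
    simp [legPoly] at r hne ⊢
    field_simp
    ring
  | one =>
    have hne := den_ne d hd 0
    have hne1 := den_ne d hd 1
    simp [legPoly] at hne hne1 ⊢
    field_simp
    ring
  | more l h1 h2 =>
    have r0 := legPoly_rec (d + 2) (by omega) l t
    have r1 := legPoly_rec d hd (l + 1) t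
    have r2 := legPoly_rec d hd (l + 2) t
    have n1 := den_ne (d + 2) (by omega) l
    have n2 : (l : ℂ) + 2 ≠ 0 := by exact_mod_cast Nat.succ_ne_zero (l + 1)
    have e4 : l + 1 + 1 = l + 2 := rfl
    have e5 : l + 1 + 2 = l + 3 := rfl
    have e6 : l + 2 + 1 = l + 3 := rfl
    rw [e4] at *
    rw [e5] at *
    rw [e6] at *
    push_cast at *
    generalize (legPoly (d+2) (l + 2)).eval t = A' at *
    generalize (legPoly (d+2) (l + 1)).eval t = B' at *
    generalize (legPoly (d+2) l).eval t = C' at *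
    generalize (legPoly d (l + 1)).eval t = L1 at *
    generalize (legPoly d (l + 2)).eval t = L2 at *
    generalize (legPoly d (l + 3)).eval t = L3 at *
    generalize (legPoly d (l + 2 + 2)).eval t = L4 at *
    apply mul_left_cancel₀ (mul_ne_zero n1 n2)
    linear_combination ((l:ℂ)+3)*((l:ℂ)+2)*(1-t^2) * r0 + ((l:ℂ)+3)*(2*l+d+2)*t*h2
      - ((l:ℂ)+3)*((l:ℂ)+2)*h1 + ((l:ℂ)+2)*((d:ℂ)-1)*r2 - ((l:ℂ)+3)*((d:ℂ)-1)*t*r1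

lemma one_sub_sq_pos' {t : ℝ} (ht : t ∈ Set.Ioo (-1 : ℝ) 1) : 0 < 1 - t ^ 2 := by
  nlinarith [ht.1, ht.2]

lemma weight_deriv (b : ℝ) {t : ℝ} (ht : t ∈ Set.Ioo (-1 : ℝ) 1) :
    deriv (fun s : ℝ => (1 - s ^ 2) ^ b) t = (-2 * b) * (t * (1 - t ^ 2) ^ (b - 1)) := by
  have h0 := one_sub_sq_pos' ht
  have h1 : HasDerivAt (fun s : ℝ => 1 - s ^ 2) (-(2 * t)) t := by
    simpa using (hasDerivAt_pow 2 t).const_sub 1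
  rw [(h1.rpow_const (Or.inl h0.ne')).deriv]
  ring

lemma weight_iter_rec (b : ℝ) {t : ℝ} (ht : t ∈ Set.Ioo (-1 : ℝ) 1) (n : ℕ) :
    iteratedDeriv (n + 2) (fun s : ℝ => (1 - s ^ 2) ^ b) t =
      (-2 * b) * (t * iteratedDeriv (n + 1) (fun s : ℝ => (1 - s ^ 2) ^ (b - 1)) t
        + (n + 1) * iteratedDeriv n (fun s : ℝ => (1 - s ^ 2) ^ (b - 1)) t) := by
  have h0 := one_sub_sq_pos' ht
  have e : deriv (fun s : ℝ => (1 - s ^ 2) ^ b) =ᶠ[nhds t]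
      fun s => (-2 * b) * (s * (1 - s ^ 2) ^ (b - 1)) := by
    filter_upwards [isOpen_Ioo.mem_nhds ht] with s hs using weight_deriv b hs
  have hc : ContDiffAt ℝ ((n + 1 : ℕ) : WithTop ℕ∞) (fun s : ℝ => (1 - s ^ 2) ^ (b - 1)) t :=
    ContDiffAt.rpow_const_of_ne (by fun_prop) h0.ne'
  rw [iteratedDeriv_succ', e.iteratedDeriv_eq, iteratedDeriv_const_mul_field,
    iteratedDeriv_fun_mul contDiffAt_fun_id hc,
    Finset.sum_range_succ', Finset.sum_range_succ']
  have : ∀ k ∈ Finset.range n, (((n + 1).choose (k + 1 + 1) : ℕ) : ℝ) *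
      iteratedDeriv (k + 1 + 1) (fun x : ℝ => x) t *
      iteratedDeriv (n + 1 - (k + 1 + 1)) (fun s : ℝ => (1 - s ^ 2) ^ (b - 1)) t = 0 := by
    intro k _
    rw [iteratedDeriv_fun_id]
    simp
  rw [Finset.sum_eq_zero this]
  simp only [iteratedDeriv_fun_id]
  simp
  left
  ring

lemma legendreRHS_zero (d : ℕ) (hd : 2 ≤ d) {t : ℝ} (ht : t ∈ Set.Ioo (-1 : ℝ) 1) :
    legendreRHS d 0 t = 1 := by
  have h0 := one_sub_sq_pos' ht
  have hd' : (2 : ℝ) ≤ d := by exact_mod_cast hd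
  have hG := (Real.Gamma_pos_of_pos (show 0 < ((d : ℝ) - 1) / 2 by linarith)).ne'
  simp only [legendreRHS, iteratedDeriv_zero, pow_zero, Nat.cast_zero, zero_add, one_mul]
  rw [mul_assoc, ← Real.rpow_add h0]
  simp [hG]

lemma legendreRHS_one (d : ℕ) (hd : 2 ≤ d) {t : ℝ} (ht : t ∈ Set.Ioo (-1 : ℝ) 1) :
    legendreRHS d 1 t = t := by
  have h0 := one_sub_sq_pos' ht
  have hd' : (2 : ℝ) ≤ d := by exact_mod_cast hd
  have hA : 0 < ((d : ℝ) - 1) / 2 := by linarith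
  have hG := (Real.Gamma_pos_of_pos hA).ne'
  simp only [legendreRHS, iteratedDeriv_one, pow_one, Nat.cast_one]
  rw [weight_deriv _ ht, add_comm (1 : ℝ) (((d : ℝ) - 1) / 2), Real.Gamma_add_one hA.ne']
  have e : (1 - t ^ 2) ^ (-(((d : ℝ) - 3) / 2)) * (1 - t ^ 2) ^ (1 + ((d : ℝ) - 3) / 2 - 1) = 1 := by
    rw [← Real.rpow_add h0]; ring_nf; simp
  have hA2 : (d : ℝ) - 1 ≠ 0 := by linarith
  generalize (1 - t ^ 2) ^ (-(((d : ℝ) - 3) / 2)) = x at *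
  generalize (1 - t ^ 2) ^ (1 + ((d : ℝ) - 3) / 2 - 1) = y at *
  field_simp
  linear_combination t * (d - 1) * e

lemma legendreRHS_rec (d : ℕ) (hd : 2 ≤ d) {t : ℝ} (ht : t ∈ Set.Ioo (-1 : ℝ) 1) (l : ℕ) :
    ((d : ℝ) - 1) * legendreRHS d (l + 2) t = ((d : ℝ) - 1) * t * legendreRHS d (l + 1) t
      - ((l : ℝ) + 1) * (1 - t ^ 2) * legendreRHS (d + 2) l t := by
  have h0 := one_sub_sq_pos' ht
  have hd' : (2 : ℝ) ≤ d := by exact_mod_cast hd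
  have hA : 0 < ((d : ℝ) - 1) / 2 := by linarith
  have hl : (0 : ℝ) ≤ l := Nat.cast_nonneg l
  have hlA : 0 < (l : ℝ) + 1 + ((d : ℝ) - 1) / 2 := by positivity
  have hG := (Real.Gamma_pos_of_pos hA).ne'
  have hG2 := (Real.Gamma_pos_of_pos hlA).ne'
  simp only [legendreRHS]
  rw [weight_iter_rec _ ht]
  have e1 : ((l + 2 : ℕ) : ℝ) + ((d : ℝ) - 3) / 2 - 1 = ((l + 1 : ℕ) : ℝ) + ((d : ℝ) - 3) / 2 := by
    push_cast; ring
  have e2 : (l : ℝ) + (((d + 2 : ℕ) : ℝ) - 3) / 2 = ((l + 1 : ℕ) : ℝ) + ((d : ℝ) - 3) / 2 := by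
    push_cast; ring
  have e3 : (((d + 2 : ℕ) : ℝ) - 1) / 2 = ((d : ℝ) - 1) / 2 + 1 := by push_cast; ring
  have e4 : ((l + 2 : ℕ) : ℝ) + ((d : ℝ) - 1) / 2 = ((l : ℝ) + 1 + ((d : ℝ) - 1) / 2) + 1 := by
    push_cast; ring
  have e5 : (l : ℝ) + (((d : ℝ) - 1) / 2 + 1) = (l : ℝ) + 1 + ((d : ℝ) - 1) / 2 := by ring
  have e6 : ((l + 1 : ℕ) : ℝ) + ((d : ℝ) - 1) / 2 = (l : ℝ) + 1 + ((d : ℝ) - 1) / 2 := by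
    push_cast; ring
  have e7 : -((((d + 2 : ℕ) : ℝ) - 3) / 2) = -(((d : ℝ) - 3) / 2) - 1 := by push_cast; ring
  rw [e1, e2, e3, e4, e5, e6, e7, Real.Gamma_add_one hA.ne', Real.Gamma_add_one hlA.ne',
    Real.rpow_sub_one h0.ne']
  generalize iteratedDeriv (l + 1)
    (fun s : ℝ => (1 - s ^ 2) ^ (((l + 1 : ℕ) : ℝ) + ((d : ℝ) - 3) / 2)) t = F
  generalize iteratedDeriv l
    (fun s : ℝ => (1 - s ^ 2) ^ (((l + 1 : ℕ) : ℝ) + ((d : ℝ) - 3) / 2)) t = F'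
  generalize (1 - t ^ 2) ^ (-(((d : ℝ) - 3) / 2)) = x at *
  generalize Real.Gamma (((d : ℝ) - 1) / 2) = g1 at *
  generalize Real.Gamma ((l : ℝ) + 1 + ((d : ℝ) - 1) / 2) = g2 at *
  have hp : (2 : ℝ) ^ l ≠ 0 := by positivity
  have h0' := h0.ne'
  have hlA' : (2 * ((l : ℝ) + 1) + (d - 1)) ≠ 0 := by nlinarith
  push_cast
  rw [pow_succ, pow_succ, pow_succ, pow_succ]
  field_simp
  ring

lemma legendre_eq (l : ℕ) : ∀ (d : ℕ), 2 ≤ d → ∀ {t : ℝ}, t ∈ Set.Ioo (-1 : ℝ) 1 →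
    (legPoly d l).eval (t : ℂ) = (legendreRHS d l t : ℂ) := by
  induction l using Nat.twoStepInduction with
  | zero => intro d hd t ht; simp [legPoly, legendreRHS_zero d hd ht]
  | one => intro d hd t ht; simp [legPoly, legendreRHS_one d hd ht]
  | more l h1 h2 =>
    intro d hd t ht
    have r := congrArg (fun z : ℝ => (z : ℂ)) (legendreRHS_rec d hd ht l)
    have r' := legPoly_shift d hd (t : ℂ) l
    have hne := den_ne d hd 0
    rw [h1 (d + 2) (by omega) ht, h2 d hd ht] at r'
    push_cast at r r' hne
    rw [zero_add] at hne
    apply mul_left_cancel₀ hne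
    linear_combination r' - r

lemma eq_legPoly (d : ℕ) (hd : 2 ≤ d) (l : ℕ) (P : Polynomial ℂ) (hP : IsLegendre d l P) :
    P = legPoly d l := by
  apply Polynomial.eq_of_infinite_eval_eq
  have hinf : ((fun t : ℝ => (t : ℂ)) '' Set.Ioo (-1 : ℝ) 1).Infinite :=
    (Set.Ioo_infinite (by norm_num)).image Complex.ofReal_injective.injOn
  refine hinf.mono ?_
  rintro _ ⟨t, ht, rfl⟩
  show P.eval (t : ℂ) = _
  rw [hP.2 t ht, legendre_eq l d hd ht]

/-- Auxiliary entire function `∑ z^n / (n! Γ(ν+n))`. -/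
noncomputable def besS (ν : ℝ) (z : ℂ) : ℂ :=
  ∑' n : ℕ, z ^ n / ((n.factorial : ℂ) * (Real.Gamma (ν + n) : ℂ))

lemma Gamma_le_Gamma_add (ν : ℝ) (hν : 1 ≤ ν) (n : ℕ) : Real.Gamma ν ≤ Real.Gamma (ν + n) := by
  induction n with
  | zero => simp
  | succ n ih =>
    have h : 0 < ν + n := by positivity
    have e : ν + ((n + 1 : ℕ) : ℝ) = ν + n + 1 := by push_cast; ring
    rw [e, Real.Gamma_add_one h.ne']
    have := Real.Gamma_pos_of_pos h
    have hn : (0 : ℝ) ≤ n := Nat.cast_nonneg n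
    nlinarith

lemma besS_term_bound (ν : ℝ) (hν : 1 ≤ ν) (z : ℂ) (R : ℝ) (hz : ‖z‖ ≤ R) (n : ℕ) :
    ‖z ^ n / ((n.factorial : ℂ) * (Real.Gamma (ν + n) : ℂ))‖ ≤
      (Real.Gamma ν)⁻¹ * (R ^ n / n.factorial) := by
  have h1 := Gamma_le_Gamma_add ν hν n
  have h2 := Real.Gamma_pos_of_pos (by linarith : 0 < ν)
  have h3 : 0 < Real.Gamma (ν + n) := by linarith
  have hf : (0 : ℝ) < n.factorial := by exact_mod_cast n.factorial_pos
  rw [norm_div, norm_mul, norm_pow, Complex.norm_natCast, Complex.norm_real, Real.norm_of_nonneg h3.le]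
  rw [inv_mul_eq_div, div_div]
  have hR : 0 ≤ R := (norm_nonneg z).trans hz
  gcongr

lemma besS_summable (ν : ℝ) (hν : 1 ≤ ν) (z : ℂ) :
    Summable fun n : ℕ => z ^ n / ((n.factorial : ℂ) * (Real.Gamma (ν + n) : ℂ)) :=
  Summable.of_norm_bounded ((Real.summable_pow_div_factorial ‖z‖).mul_left _)
    (besS_term_bound ν hν z ‖z‖ le_rfl)

lemma besS_hasDerivAt (ν : ℝ) (hν : 1 ≤ ν) (z : ℂ) :
    HasDerivAt (besS ν) (besS (ν + 1) z) z := by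
  have hν1 : 1 ≤ ν + 1 := by linarith
  have key : ∀ (n : ℕ) (y : ℂ), ((n + 1 : ℕ) : ℂ) * y ^ n /
      (((n + 1).factorial : ℂ) * (Real.Gamma (ν + ((n + 1 : ℕ) : ℝ)) : ℂ)) =
      y ^ n / ((n.factorial : ℂ) * (Real.Gamma (ν + 1 + n) : ℂ)) := by
    intro n y
    have e : ν + ((n + 1 : ℕ) : ℝ) = ν + 1 + n := by push_cast; ring
    rw [e, Nat.factorial_succ]
    have hn : ((n + 1 : ℕ) : ℂ) ≠ 0 := Nat.cast_ne_zero.mpr (Nat.succ_ne_zero n)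
    rw [Nat.cast_mul, mul_assoc, mul_div_mul_left _ _ hn]
  let g' : ℕ → ℂ → ℂ := fun n y =>
    (n : ℂ) * y ^ (n - 1) / ((n.factorial : ℂ) * (Real.Gamma (ν + n) : ℂ))
  let R : ℝ := ‖z‖ + 1
  let u : ℕ → ℝ := fun n => match n with
    | 0 => 0
    | (n + 1) => (Real.Gamma (ν + 1))⁻¹ * (R ^ n / n.factorial)
  have hu : Summable u := by
    rw [← summable_nat_add_iff 1]
    exact (Real.summable_pow_div_factorial R).mul_left _
  have hmem : z ∈ Metric.ball (0 : ℂ) R := by simp [R]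
  have h := hasDerivAt_tsum_of_isPreconnected (𝕜 := ℂ) (u := u)
    (g := fun n y => y ^ n / ((n.factorial : ℂ) * (Real.Gamma (ν + n) : ℂ))) (g' := g')
    (t := Metric.ball (0 : ℂ) R) hu Metric.isOpen_ball (convex_ball _ _).isPreconnected
    (fun n y _ => (hasDerivAt_pow n y).div_const _)
    (by
      intro n y hy
      rcases n with _ | n
      · simp [g', u]
      · simp only [g', u, Nat.add_sub_cancel]
        rw [key]
        apply besS_term_bound (ν + 1) hν1
        have : ‖y‖ < R := by simpa using hy
        exact this.le)
    hmem (besS_summable ν hν z) hmem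
  have hs : ∑' n, g' n z = besS (ν + 1) z := by
    have hsum : Summable fun n => g' n z := by
      rw [← summable_nat_add_iff 1]
      simp only [g', Nat.add_sub_cancel]
      simp_rw [key]
      exact besS_summable (ν + 1) hν1 z
    rw [hsum.tsum_eq_zero_add]
    simp only [g', Nat.add_sub_cancel]
    simp_rw [key]
    simp [besS]
  rw [hs] at h
  exact h

lemma besS_rec (ν : ℝ) (hν : 1 ≤ ν) (z : ℂ) :
    besS ν z - z * besS (ν + 2) z = ν * besS (ν + 1) z := by
  have s0 := besS_summable ν hν z
  have s1 := besS_summable (ν + 1) (by linarith) z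
  have s2 := besS_summable (ν + 2) (by linarith) z
  have h0 : besS ν z = _ := s0.tsum_eq_zero_add
  have h1 : besS (ν + 1) z = _ := s1.tsum_eq_zero_add
  have s0' := (summable_nat_add_iff 1).mpr s0
  have s1' := (summable_nat_add_iff 1).mpr s1
  have hg := (Real.Gamma_pos_of_pos (by linarith : 0 < ν)).ne'
  rw [h0, h1, besS, ← tsum_mul_left, mul_add, ← tsum_mul_left, add_sub_assoc,
    ← s0'.tsum_sub (s2.mul_left z)]
  congr 1
  · simp only [pow_zero, Nat.factorial_zero, Nat.cast_zero, add_zero, Nat.cast_one, one_mul]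
    rw [Real.Gamma_add_one (by linarith)]
    have : (ν : ℂ) ≠ 0 := by exact_mod_cast (by linarith : ν ≠ 0)
    have : (Real.Gamma ν : ℂ) ≠ 0 := by exact_mod_cast hg
    push_cast
    field_simp
  · apply tsum_congr
    intro n
    have e1 : ν + 2 + (n : ℝ) = (ν + ((n + 1 : ℕ) : ℝ)) + 1 := by push_cast; ring
    have e2 : ν + 1 + ((n + 1 : ℕ) : ℝ) = (ν + ((n + 1 : ℕ) : ℝ)) + 1 := by push_cast; ring
    have hp : 0 < ν + ((n + 1 : ℕ) : ℝ) := by positivity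
    rw [e1, e2, Real.Gamma_add_one hp.ne', Nat.factorial_succ]
    have hG : (Real.Gamma (ν + ((n + 1 : ℕ) : ℝ)) : ℂ) ≠ 0 := by
      exact_mod_cast (Real.Gamma_pos_of_pos hp).ne'
    have hp' : ((ν + ((n + 1 : ℕ) : ℝ) : ℝ) : ℂ) ≠ 0 := by exact_mod_cast hp.ne'
    have hn : ((n + 1 : ℕ) : ℂ) ≠ 0 := Nat.cast_ne_zero.mpr (Nat.succ_ne_zero n)
    have hf : (n.factorial : ℂ) ≠ 0 := by exact_mod_cast n.factorial_ne_zero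
    generalize Real.Gamma (ν + ((n + 1 : ℕ) : ℝ)) = G at *
    push_cast at *
    field_simp
    ring

lemma hasSum_congr_aux {f g : ℕ → ℂ} {a : ℂ} (h : ∀ n, f n = g n) (hg : HasSum g a) : HasSum f a := by
  rw [funext h]; exact hg

lemma coeff_unique (a b : ℕ → ℂ) (f : ℂ → ℂ) (h1 : ∀ s, HasSum (fun n => s ^ n * a n) (f s))
    (h2 : ∀ s, HasSum (fun n => s ^ n * b n) (f s)) : a = b := by
  have H : ∀ c : ℕ → ℂ, (∀ s, HasSum (fun n => s ^ n * c n) (f s)) →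
      HasFPowerSeriesAt f (FormalMultilinearSeries.ofScalars ℂ c) 0 := by
    intro c hc
    rw [hasFPowerSeriesAt_iff]
    refine Filter.Eventually.of_forall fun z => ?_
    simpa [FormalMultilinearSeries.coeff_ofScalars] using hc z
  have e := (H a h1).eq_formalMultilinearSeries (H b h2)
  funext n
  have := congrArg (fun p => FormalMultilinearSeries.coeff p n) e
  simpa [FormalMultilinearSeries.coeff_ofScalars] using this

/-- The bilinear product `ζ · z` of a complex vector and a real vector. -/
noncomputable def dotc {d : ℕ} (ζ : Fin d → ℂ) (z : EuclideanSpace ℝ (Fin d)) : ℂ :=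
  ∑ i, ζ i * (z i : ℂ)

lemma dotc_continuous {d : ℕ} (ζ : Fin d → ℂ) : Continuous (dotc ζ) := by
  unfold dotc
  fun_prop

lemma dotc_smul {d : ℕ} (ζ : Fin d → ℂ) (r : ℝ) (z : EuclideanSpace ℝ (Fin d)) :
    dotc ζ (r • z) = r * dotc ζ z := by
  simp only [dotc, PiLp.smul_apply, smul_eq_mul, Complex.ofReal_mul, Finset.mul_sum]
  exact Finset.sum_congr rfl fun i _ => by ring

lemma dotc_norm_le {d : ℕ} (ζ : Fin d → ℂ) (z : EuclideanSpace ℝ (Fin d)) :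
    ‖dotc ζ z‖ ≤ (∑ i, ‖ζ i‖) * ‖z‖ := by
  unfold dotc
  refine (norm_sum_le _ _).trans ?_
  rw [Finset.sum_mul]
  refine Finset.sum_le_sum fun i _ => ?_
  rw [norm_mul, Complex.norm_real]
  gcongr
  exact PiLp.norm_apply_le z i

lemma gauss_integral {d : ℕ} (ζ : Fin d → ℂ) (s : ℂ) :
    ∫ z : EuclideanSpace ℝ (Fin d), Complex.exp (s * dotc ζ z) * Complex.exp (-(‖z‖ : ℂ) ^ 2) =
      ((Real.pi ^ ((d : ℝ) / 2) : ℝ) : ℂ) * Complex.exp (s ^ 2 * ((∑ i, ζ i * ζ i) / 4)) := by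
  have h := GaussianFourier.integral_cexp_neg_mul_sum_add (b := 1) (by simp) (fun i => s * ζ i)
  rw [← (PiLp.volume_preserving_toLp (Fin d)).integral_comp
    (MeasurableEquiv.toLp 2 _).measurableEmbedding]
  have e1 : ((Real.pi ^ ((d : ℝ) / 2) : ℝ) : ℂ) = ((Real.pi : ℂ) / 1) ^ ((Fintype.card (Fin d) : ℂ) / 2) := by
    rw [Complex.ofReal_cpow Real.pi_pos.le]
    simp
  have e2 : s ^ 2 * ((∑ i, ζ i * ζ i) / 4) = (∑ i, (s * ζ i) ^ 2) / (4 * 1) := by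
    rw [mul_one, mul_div_assoc', Finset.mul_sum]
    congr 1
    exact Finset.sum_congr rfl fun i _ => by ring
  rw [e1, e2, ← h]
  congr 1
  funext v
  rw [← Complex.exp_add]
  congr 1
  have e3 : ((‖(WithLp.toLp 2 v : EuclideanSpace ℝ (Fin d))‖ : ℝ) : ℂ) ^ 2 = ∑ i, (v i : ℂ) ^ 2 := by
    rw [← Complex.ofReal_pow, EuclideanSpace.norm_sq_eq]
    simp
  rw [e3, dotc, Finset.mul_sum, neg_one_mul, add_comm]
  congr 1
  exact Finset.sum_congr rfl fun i _ => by simp [mul_assoc]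

lemma gauss_integrable (d : ℕ) (K : ℝ) :
    Integrable (fun z : EuclideanSpace ℝ (Fin d) => Real.exp (K * ‖z‖) * Real.exp (-‖z‖ ^ 2)) := by
  have h := (GaussianFourier.integrable_cexp_neg_mul_sq_norm_add (V := EuclideanSpace ℝ (Fin d))
    (b := ((1 / 2 : ℝ) : ℂ)) (by rw [Complex.ofReal_re]; norm_num) 0 0).norm
  refine (h.const_mul (Real.exp (K ^ 2 / 2))).mono' (by fun_prop) ?_
  refine Filter.Eventually.of_forall fun z => ?_
  rw [Real.norm_of_nonneg (by positivity), Complex.norm_exp]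
  have : (-((1 / 2 : ℝ) : ℂ) * (‖z‖ : ℂ) ^ 2 + 0 * ((inner ℝ 0 z : ℝ) : ℂ)).re = -(1 / 2) * ‖z‖ ^ 2 := by
    rw [zero_mul, add_zero]
    norm_cast
  rw [this, ← Real.exp_add, ← Real.exp_add]
  apply Real.exp_le_exp.mpr
  nlinarith [sq_nonneg (K - ‖z‖)]

lemma gauss_hasSum {d : ℕ} (ζ : Fin d → ℂ) (s : ℂ) :
    HasSum (fun k : ℕ => s ^ k * ((∫ z : EuclideanSpace ℝ (Fin d),
        dotc ζ z ^ k * Complex.exp (-(‖z‖ : ℂ) ^ 2)) / k.factorial))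
      (((Real.pi ^ ((d : ℝ) / 2) : ℝ) : ℂ) * Complex.exp (s ^ 2 * ((∑ i, ζ i * ζ i) / 4))) := by
  rw [← gauss_integral]
  have hc := dotc_continuous ζ
  have hnorm : ∀ z : EuclideanSpace ℝ (Fin d),
      ‖Complex.exp (-(‖z‖ : ℂ) ^ 2)‖ = Real.exp (-‖z‖ ^ 2) := by
    intro z
    rw [Complex.norm_exp]
    congr 1
    norm_cast
  have key := hasSum_integral_of_dominated_convergence
    (μ := (volume : Measure (EuclideanSpace ℝ (Fin d))))
    (F := fun (k : ℕ) z => (s * dotc ζ z) ^ k / k.factorial * Complex.exp (-(‖z‖ : ℂ) ^ 2))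
    (f := fun z => Complex.exp (s * dotc ζ z) * Complex.exp (-(‖z‖ : ℂ) ^ 2))
    (fun k z => ‖s * dotc ζ z‖ ^ k / k.factorial * Real.exp (-‖z‖ ^ 2))
    (fun k => by
      apply Continuous.aestronglyMeasurable
      fun_prop)
    (fun k => Filter.Eventually.of_forall fun z => by
      rw [norm_mul, hnorm, norm_div, norm_pow, Complex.norm_natCast])
    (Filter.Eventually.of_forall fun z => (Real.summable_pow_div_factorial _).mul_right _)
    (by
      have e : (fun z : EuclideanSpace ℝ (Fin d) =>
          ∑' k : ℕ, ‖s * dotc ζ z‖ ^ k / k.factorial * Real.exp (-‖z‖ ^ 2)) =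
          fun z => Real.exp ‖s * dotc ζ z‖ * Real.exp (-‖z‖ ^ 2) := by
        funext z
        rw [tsum_mul_right, Real.exp_eq_exp_ℝ, NormedSpace.exp_eq_tsum_div]
      rw [e]
      refine (gauss_integrable d (‖s‖ * ∑ i, ‖ζ i‖)).mono' (by fun_prop) ?_
      refine Filter.Eventually.of_forall fun z => ?_
      rw [Real.norm_of_nonneg (by positivity)]
      gcongr
      rw [norm_mul, mul_assoc]
      gcongr
      exact dotc_norm_le ζ z)
    (Filter.Eventually.of_forall fun z => by
      apply HasSum.mul_right
      rw [Complex.exp_eq_exp_ℂ]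
      exact NormedSpace.expSeries_div_hasSum_exp _)
  refine (hasSum_congr_aux fun k => ?_) key
  rw [mul_div_assoc', ← integral_const_mul, ← integral_div]
  congr 1
  funext z
  ring

lemma gauss_hasSum' (q s : ℂ) (c : ℂ) :
    HasSum (fun k : ℕ => s ^ k * (if Even k then c * ((q / 4) ^ (k / 2) / (k / 2).factorial) else 0))
      (c * Complex.exp (s ^ 2 * (q / 4))) := by
  have h : HasSum (fun n : ℕ => (s ^ 2 * (q / 4)) ^ n / n.factorial) (Complex.exp (s ^ 2 * (q / 4))) := by
    rw [Complex.exp_eq_exp_ℂ]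
    exact NormedSpace.expSeries_div_hasSum_exp _
  have hinj : Function.Injective (fun n : ℕ => 2 * n) := fun a b h => by simpa using h
  rw [← hinj.hasSum_iff]
  · refine (hasSum_congr_aux fun n => ?_) (h.mul_left c)
    simp [mul_pow, ← pow_mul]
    ring
  · intro k hk
    rw [if_neg, mul_zero]
    rintro ⟨m, rfl⟩
    exact hk ⟨m, by simp [two_mul]⟩

lemma gauss_moment {d : ℕ} (ζ : Fin d → ℂ) (k : ℕ) :
    ∫ z : EuclideanSpace ℝ (Fin d), dotc ζ z ^ k * Complex.exp (-(‖z‖ : ℂ) ^ 2) =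
      k.factorial * (if Even k then ((Real.pi ^ ((d : ℝ) / 2) : ℝ) : ℂ) *
        (((∑ i, ζ i * ζ i) / 4) ^ (k / 2) / (k / 2).factorial) else 0) := by
  have := congrFun (coeff_unique _ _ _ (gauss_hasSum ζ) (fun s => gauss_hasSum' _ s _)) k
  have hk : (k.factorial : ℂ) ≠ 0 := by exact_mod_cast k.factorial_ne_zero
  rw [← this]
  field_simp

lemma polar_moment {d : ℕ} (hd : 2 ≤ d) (ζ : Fin d → ℂ) (k : ℕ) :
    ∫ z : EuclideanSpace ℝ (Fin d), dotc ζ z ^ k * Complex.exp (-(‖z‖ : ℂ) ^ 2) =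
      (∫ y, dotc ζ (y : EuclideanSpace ℝ (Fin d)) ^ k ∂ sphMeasure d) *
        ((1 / 2 * Real.Gamma (((k : ℝ) + d) / 2) : ℝ) : ℂ) := by
  let μ : Measure (EuclideanSpace ℝ (Fin d)) := volume
  have hdim : Module.finrank ℝ (EuclideanSpace ℝ (Fin d)) = d := by simp
  let g : ℝ → ℂ := fun r => ((r ^ k * Real.exp (-r ^ 2) : ℝ) : ℂ)
  calc
    _ = ∫ x : ({(0)}ᶜ : Set (EuclideanSpace ℝ (Fin d))),
        dotc ζ x.1 ^ k * Complex.exp (-(‖x.1‖ : ℂ) ^ 2) ∂(μ.comap (↑)) := by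
      rw [integral_subtype_comap (measurableSet_singleton _).compl
        fun x : EuclideanSpace ℝ (Fin d) ↦ dotc ζ x ^ k * Complex.exp (-(‖x‖ : ℂ) ^ 2)]
      have : Nonempty (Fin d) := ⟨⟨0, by omega⟩⟩
      rw [restrict_compl_singleton]
    _ = ∫ p : Metric.sphere (0 : EuclideanSpace ℝ (Fin d)) 1 × Set.Ioi (0 : ℝ),
        dotc ζ p.1.1 ^ k * g p.2.1 ∂μ.toSphere.prod
          (.volumeIoiPow (Module.finrank ℝ (EuclideanSpace ℝ (Fin d)) - 1)) := by
      rw [← μ.measurePreserving_homeomorphUnitSphereProd.integral_comp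
        (Homeomorph.measurableEmbedding _)]
      congr 1
      funext x
      have hx : (‖x.1‖ : ℂ) ≠ 0 := by
        exact_mod_cast norm_ne_zero_iff.mpr x.2
      simp only [homeomorphUnitSphereProd_apply_snd_coe, homeomorphUnitSphereProd_apply_fst_coe,
        dotc_smul, g]
      push_cast
      rw [mul_pow, inv_pow]
      field_simp
    _ = (∫ y, dotc ζ (y : EuclideanSpace ℝ (Fin d)) ^ k ∂ μ.toSphere) *
        ∫ r : Set.Ioi (0 : ℝ), g r.1 ∂(.volumeIoiPow
          (Module.finrank ℝ (EuclideanSpace ℝ (Fin d)) - 1)) :=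
      integral_prod_mul (fun y : Metric.sphere (0 : EuclideanSpace ℝ (Fin d)) 1 => dotc ζ y.1 ^ k)
        (fun r : Set.Ioi (0 : ℝ) => g r.1)
    _ = _ := by
      congr 1
      rw [hdim]
      simp only [Measure.volumeIoiPow, ENNReal.ofReal]
      rw [integral_withDensity_eq_integral_smul,
        integral_subtype_comap measurableSet_Ioi fun a ↦ Real.toNNReal (a ^ (d - 1)) • g a,
        setIntegral_congr_fun (g := fun x : ℝ =>
          ((x ^ ((k : ℝ) + d - 1) * Real.exp (-x ^ (2 : ℝ)) : ℝ) : ℂ)) measurableSet_Ioi]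
      · rw [integral_complex_ofReal, integral_rpow_mul_exp_neg_rpow (by norm_num)]
        · congr 3
          ring
        · have : (2 : ℝ) ≤ d := by exact_mod_cast hd
          have : (0 : ℝ) ≤ k := Nat.cast_nonneg k
          linarith
      · intro x hx
        have hx0 : (0 : ℝ) < x := hx
        simp only [g]
        rw [NNReal.smul_def, Real.coe_toNNReal _ (pow_nonneg hx0.le _), Complex.real_smul,
          ← Complex.ofReal_mul, ← mul_assoc, ← pow_add]
        congr 2
        · rw [← Real.rpow_natCast]
          congr 1
          rw [Nat.cast_add, Nat.cast_sub (by omega)]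
          push_cast
          ring
        · norm_cast
      · exact (measurable_subtype_coe.pow_const _).real_toNNReal

lemma sphere_moment {d : ℕ} (hd : 2 ≤ d) (ζ : Fin d → ℂ) (k : ℕ) :
    (∫ y, dotc ζ (y : EuclideanSpace ℝ (Fin d)) ^ k ∂ sphMeasure d) / k.factorial =
      if Even k then 2 * ((Real.pi ^ ((d : ℝ) / 2) : ℝ) : ℂ) *
        (((∑ i, ζ i * ζ i) / 4) ^ (k / 2) /
          ((k / 2).factorial * (Real.Gamma (((k : ℝ) + d) / 2) : ℂ))) else 0 := by
  have h := (polar_moment hd ζ k).symm.trans (gauss_moment ζ k)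
  have hk : (k.factorial : ℂ) ≠ 0 := by exact_mod_cast k.factorial_ne_zero
  have hk2 : ((k / 2).factorial : ℂ) ≠ 0 := by exact_mod_cast (k / 2).factorial_ne_zero
  have hG : (Real.Gamma (((k : ℝ) + d) / 2) : ℂ) ≠ 0 := by
    have : 0 < ((k : ℝ) + d) / 2 := by positivity
    exact_mod_cast (Real.Gamma_pos_of_pos this).ne'
  generalize Real.Gamma (((k : ℝ) + d) / 2) = G at *
  push_cast at h ⊢
  split_ifs at h ⊢ with he
  · field_simp at h ⊢
    linear_combination h
  · simpa [hG, Nat.factorial_ne_zero] using h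

instance sphMeasure_finite (d : ℕ) : IsFiniteMeasure (sphMeasure d) := by
  unfold sphMeasure; infer_instance

lemma sphere_exp {d : ℕ} (hd : 2 ≤ d) (ζ : Fin d → ℂ) :
    ∫ y, Complex.exp (dotc ζ (y : EuclideanSpace ℝ (Fin d))) ∂ sphMeasure d =
      2 * ((Real.pi ^ ((d : ℝ) / 2) : ℝ) : ℂ) * besS ((d : ℝ) / 2) ((∑ i, ζ i * ζ i) / 4) := by
  have hc := dotc_continuous ζ
  have key := hasSum_integral_of_dominated_convergence (μ := sphMeasure d)
    (F := fun (k : ℕ) y => dotc ζ (y : EuclideanSpace ℝ (Fin d)) ^ k / k.factorial)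
    (f := fun y => Complex.exp (dotc ζ (y : EuclideanSpace ℝ (Fin d))))
    (fun k _ => (∑ i, ‖ζ i‖) ^ k / k.factorial)
    (fun k => by
      apply Continuous.aestronglyMeasurable
      fun_prop)
    (fun k => Filter.Eventually.of_forall fun y => by
      rw [norm_div, norm_pow, Complex.norm_natCast]
      have h := dotc_norm_le ζ (y : EuclideanSpace ℝ (Fin d))
      have hy : ‖(y : EuclideanSpace ℝ (Fin d))‖ = 1 := by simpa using y.2
      rw [hy, mul_one] at h
      gcongr)
    (Filter.Eventually.of_forall fun z => Real.summable_pow_div_factorial _)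
    (integrable_const _)
    (Filter.Eventually.of_forall fun z => by
      rw [Complex.exp_eq_exp_ℂ]
      exact NormedSpace.expSeries_div_hasSum_exp _)
  simp_rw [integral_div, sphere_moment hd] at key
  have hinj : Function.Injective (fun n : ℕ => 2 * n) := fun a b h => by simpa using h
  rw [← hinj.hasSum_iff] at key
  · rw [← key.tsum_eq, besS, ← tsum_mul_left]
    apply tsum_congr
    intro n
    have e : (((2 * n : ℕ) : ℝ) + d) / 2 = (d : ℝ) / 2 + n := by push_cast; ring
    simp only [Function.comp_apply, e]
    simp
  · intro k hk
    rw [if_neg]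
    rintro ⟨m, rfl⟩
    exact hk ⟨m, by simp [two_mul]⟩

lemma sphere_norm {d : ℕ} (y : Metric.sphere (0 : EuclideanSpace ℝ (Fin d)) 1) :
    ‖(y : EuclideanSpace ℝ (Fin d))‖ = 1 := by simpa using y.2

/-- Weighted exponential integral over the sphere. -/
noncomputable def wInt (d : ℕ) (Q : Polynomial ℂ) (ζ : Fin d → ℂ)
    (x : EuclideanSpace ℝ (Fin d)) : ℂ :=
  ∫ y, Q.eval ((inner ℝ x (y : EuclideanSpace ℝ (Fin d)) : ℝ) : ℂ) *
    Complex.exp (dotc ζ (y : EuclideanSpace ℝ (Fin d))) ∂ sphMeasure d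

lemma sph_integrable {d : ℕ} (f : Metric.sphere (0 : EuclideanSpace ℝ (Fin d)) 1 → ℂ)
    (hf : Continuous f) : Integrable f (sphMeasure d) := by
  exact hf.integrable_of_hasCompactSupport (HasCompactSupport.of_compactSpace f)

lemma dotc_add {d : ℕ} (ζ : Fin d → ℂ) (s : ℂ) (x y : EuclideanSpace ℝ (Fin d)) :
    dotc (fun i => ζ i + s * (x i : ℂ)) y = dotc ζ y + s * ((inner ℝ x y : ℝ) : ℂ) := by
  have : ((inner ℝ x y : ℝ) : ℂ) = ∑ i, (x i : ℂ) * (y i : ℂ) := by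
    rw [PiLp.inner_apply]
    push_cast
    exact Finset.sum_congr rfl fun i _ => by simp [mul_comm]
  rw [this, dotc, dotc, Finset.mul_sum, ← Finset.sum_add_distrib]
  exact Finset.sum_congr rfl fun i _ => by ring

lemma wInt_hasDerivAt {d : ℕ} (Q : Polynomial ℂ) (ζ : Fin d → ℂ)
    (x : Metric.sphere (0 : EuclideanSpace ℝ (Fin d)) 1) :
    HasDerivAt (fun s : ℂ => wInt d Q (fun i => ζ i + s * ((x : EuclideanSpace ℝ (Fin d)) i : ℂ)) x)
      (wInt d (Polynomial.X * Q) ζ x) 0 := by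
  have hc := dotc_continuous ζ
  have hxy : ∀ y : Metric.sphere (0 : EuclideanSpace ℝ (Fin d)) 1,
      ‖((inner ℝ (x : EuclideanSpace ℝ (Fin d)) (y : EuclideanSpace ℝ (Fin d)) : ℝ) : ℂ)‖ ≤ 1 := by
    intro y
    rw [Complex.norm_real]
    have := norm_inner_le_norm (𝕜 := ℝ) (x : EuclideanSpace ℝ (Fin d)) (y : EuclideanSpace ℝ (Fin d))
    rwa [sphere_norm, sphere_norm, mul_one] at this
  let F : ℂ → Metric.sphere (0 : EuclideanSpace ℝ (Fin d)) 1 → ℂ := fun s y =>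
    Q.eval ((inner ℝ (x : EuclideanSpace ℝ (Fin d)) (y : EuclideanSpace ℝ (Fin d)) : ℝ) : ℂ) *
    Complex.exp (dotc ζ (y : EuclideanSpace ℝ (Fin d)) + s *
      ((inner ℝ (x : EuclideanSpace ℝ (Fin d)) (y : EuclideanSpace ℝ (Fin d)) : ℝ) : ℂ))
  let F' : ℂ → Metric.sphere (0 : EuclideanSpace ℝ (Fin d)) 1 → ℂ := fun s y =>
    F s y * ((inner ℝ (x : EuclideanSpace ℝ (Fin d)) (y : EuclideanSpace ℝ (Fin d)) : ℝ) : ℂ)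
  have hF : ∀ s, Continuous (F s) := by
    intro s
    have h1 := Q.continuous
    have h2 : Continuous fun y : Metric.sphere (0 : EuclideanSpace ℝ (Fin d)) 1 =>
      ((inner ℝ (x : EuclideanSpace ℝ (Fin d)) (y : EuclideanSpace ℝ (Fin d)) : ℝ) : ℂ) := by fun_prop
    have h3 := h1.comp h2
    exact h3.mul (Complex.continuous_exp.comp ((hc.comp continuous_subtype_val).add
      (continuous_const.mul h2)))
  have hF' : ∀ s, Continuous (F' s) := fun s => (hF s).mul (by fun_prop)
  have key := (hasDerivAt_integral_of_dominated_loc_of_deriv_le (μ := sphMeasure d)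
    (F := F) (F' := F') (x₀ := (0 : ℂ)) (s := Metric.ball 0 1)
    (bound := fun y => ‖F 0 y‖ * Real.exp 1)
    (Metric.ball_mem_nhds 0 one_pos)
    (Filter.Eventually.of_forall fun s => (hF s).aestronglyMeasurable)
    (sph_integrable _ (hF 0)) (hF' 0).aestronglyMeasurable
    (Filter.Eventually.of_forall fun y s hs => by
      have hs1 : ‖s‖ < 1 := by simpa using hs
      have e : F s y = F 0 y * Complex.exp (s *
          ((inner ℝ (x : EuclideanSpace ℝ (Fin d)) (y : EuclideanSpace ℝ (Fin d)) : ℝ) : ℂ)) := by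
        simp only [F]
        rw [zero_mul, add_zero, Complex.exp_add, mul_assoc]
      simp only [F']
      rw [e, norm_mul, norm_mul, mul_assoc]
      gcongr
      calc _ ≤ Real.exp 1 * 1 := by
            gcongr
            · refine (Complex.norm_exp_le_exp_norm _).trans (Real.exp_le_exp.mpr ?_)
              rw [norm_mul]
              exact mul_le_one₀ hs1.le (norm_nonneg _) (hxy y)
            · exact hxy y
        _ = _ := mul_one _)
    ((sph_integrable _ (hF 0)).norm.mul_const _)
    (Filter.Eventually.of_forall fun y s hs => by
      simp only [F', F]
      rw [mul_assoc]
      refine HasDerivAt.const_mul _ ?_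
      refine HasDerivAt.cexp ?_
      simpa using ((hasDerivAt_id s).mul_const
        ((inner ℝ (x : EuclideanSpace ℝ (Fin d)) (y : EuclideanSpace ℝ (Fin d)) : ℝ) : ℂ)).const_add
          (dotc ζ (y : EuclideanSpace ℝ (Fin d))))).2
  have e1 : (fun s : ℂ => wInt d Q (fun i => ζ i + s * ((x : EuclideanSpace ℝ (Fin d)) i : ℂ)) x) =
      fun s => ∫ y, F s y ∂ sphMeasure d := by
    funext s
    simp only [wInt, dotc_add, F]
  have e2 : wInt d (Polynomial.X * Q) ζ x = ∫ y, F' 0 y ∂ sphMeasure d := by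
    simp only [wInt, F', F]
    congr 1
    funext y
    rw [Polynomial.eval_mul, Polynomial.eval_X, zero_mul, add_zero]
    ring
  rw [e1, e2]
  exact key

lemma wInt_integrable {d : ℕ} (Q : Polynomial ℂ) (ζ : Fin d → ℂ)
    (x : EuclideanSpace ℝ (Fin d)) :
    Integrable (fun y : Metric.sphere (0 : EuclideanSpace ℝ (Fin d)) 1 =>
      Q.eval ((inner ℝ x (y : EuclideanSpace ℝ (Fin d)) : ℝ) : ℂ) *
    Complex.exp (dotc ζ (y : EuclideanSpace ℝ (Fin d)))) (sphMeasure d) := by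
  apply sph_integrable
  have h2 : Continuous fun y : Metric.sphere (0 : EuclideanSpace ℝ (Fin d)) 1 =>
      ((inner ℝ x (y : EuclideanSpace ℝ (Fin d)) : ℝ) : ℂ) := by fun_prop
  exact (Q.continuous.comp h2).mul
    (Complex.continuous_exp.comp ((dotc_continuous ζ).comp continuous_subtype_val))

lemma wInt_rec {d : ℕ} (hd : 2 ≤ d) (l : ℕ) (ζ : Fin d → ℂ) (x : EuclideanSpace ℝ (Fin d)) :
    ((l : ℂ) + d - 1) * wInt d (legPoly d (l + 2)) ζ x =
      (2 * l + d) * wInt d (Polynomial.X * legPoly d (l + 1)) ζ x -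
        (l + 1) * wInt d (legPoly d l) ζ x := by
  unfold wInt
  rw [← integral_const_mul, ← integral_const_mul, ← integral_const_mul, ← integral_sub
    ((wInt_integrable _ ζ x).const_mul _) ((wInt_integrable _ ζ x).const_mul _)]
  congr 1
  funext y
  rw [← mul_assoc, legPoly_rec d hd l, Polynomial.eval_mul, Polynomial.eval_X]
  ring

/-- The bilinear square. -/
noncomputable def qq {d : ℕ} (ζ : Fin d → ℂ) : ℂ := ∑ i, ζ i * ζ i

lemma shift_q {d : ℕ} (ζ : Fin d → ℂ) (s : ℂ)
    (x : Metric.sphere (0 : EuclideanSpace ℝ (Fin d)) 1) :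
    qq (fun i => ζ i + s * ((x : EuclideanSpace ℝ (Fin d)) i : ℂ)) =
      qq ζ + 2 * s * dotc ζ x + s ^ 2 := by
  have h1 : ∑ i, ((x : EuclideanSpace ℝ (Fin d)) i : ℂ) ^ 2 = 1 := by
    have h := EuclideanSpace.norm_sq_eq (x : EuclideanSpace ℝ (Fin d))
    rw [sphere_norm] at h
    simp only [Real.norm_eq_abs, sq_abs] at h
    have h2 := congrArg (fun r : ℝ => (r : ℂ)) h
    push_cast at h2
    rw [← h2]; norm_num
  calc _ = qq ζ + 2 * s * dotc ζ x + s ^ 2 * ∑ i, ((x : EuclideanSpace ℝ (Fin d)) i : ℂ) ^ 2 := by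
        simp only [qq, dotc, Finset.mul_sum, ← Finset.sum_add_distrib]
        exact Finset.sum_congr rfl fun i _ => by ring
    _ = _ := by rw [h1, mul_one]

lemma shift_u {d : ℕ} (ζ : Fin d → ℂ) (s : ℂ)
    (x : Metric.sphere (0 : EuclideanSpace ℝ (Fin d)) 1) :
    dotc (fun i => ζ i + s * ((x : EuclideanSpace ℝ (Fin d)) i : ℂ)) x = dotc ζ x + s := by
  rw [dotc_add, real_inner_self_eq_norm_sq, sphere_norm]
  simp

/-- Derivative of the closed form. -/
lemma closed_hasDerivAt (d : ℕ) (hd : 2 ≤ d) (l : ℕ) (u q : ℂ) :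
    HasDerivAt (fun s : ℂ => besS ((d : ℝ) / 2 + l) ((q + 2 * s * u + s ^ 2) / 4) *
        legHom d l (u + s) (q + 2 * s * u + s ^ 2))
      (besS ((d : ℝ) / 2 + l + 1) (q / 4) * (u / 2) * legHom d l u q +
        besS ((d : ℝ) / 2 + l) (q / 4) * (l * legHom d (l - 1) u q)) 0 := by
  have hν : (1 : ℝ) ≤ (d : ℝ) / 2 + l := by
    have : (2 : ℝ) ≤ d := by exact_mod_cast hd
    have : (0 : ℝ) ≤ l := Nat.cast_nonneg l
    linarith
  have hin : HasDerivAt (fun s : ℂ => (q + 2 * s * u + s ^ 2) / 4) (u / 2) 0 := by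
    have h1 : HasDerivAt (fun s : ℂ => s) 1 0 := hasDerivAt_id _
    have := ((((h1.const_mul 2).mul_const u).const_add q).add (h1.pow 2)).div_const 4
    refine this.congr_deriv ?_
    simp; ring
  have h2 : HasDerivAt (fun s : ℂ => besS ((d : ℝ) / 2 + l) ((q + 2 * s * u + s ^ 2) / 4))
      (besS ((d : ℝ) / 2 + l + 1) (q / 4) * (u / 2)) 0 := by
    have := besS_hasDerivAt _ hν (q / 4)
    refine HasDerivAt.comp (h₂ := besS ((d : ℝ) / 2 + l)) 0 ?_ hin
    simpa using this
  have := h2.mul (legHom_hasDerivAt d hd u q l)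
  refine this.congr_deriv ?_
  simp

lemma wInt_formula {d : ℕ} (hd : 2 ≤ d)
    (x : Metric.sphere (0 : EuclideanSpace ℝ (Fin d)) 1) (l : ℕ) :
    ∀ ζ : Fin d → ℂ, wInt d (legPoly d l) ζ x =
      2 * ((Real.pi ^ ((d : ℝ) / 2) : ℝ) : ℂ) * (1 / 2) ^ l *
        (besS ((d : ℝ) / 2 + l) (qq ζ / 4) * legHom d l (dotc ζ x) (qq ζ)) := by
  have step : ∀ l : ℕ, (∀ ζ : Fin d → ℂ, wInt d (legPoly d l) ζ x =
      2 * ((Real.pi ^ ((d : ℝ) / 2) : ℝ) : ℂ) * (1 / 2) ^ l *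
        (besS ((d : ℝ) / 2 + l) (qq ζ / 4) * legHom d l (dotc ζ x) (qq ζ))) →
      ∀ ζ : Fin d → ℂ, wInt d (Polynomial.X * legPoly d l) ζ x =
      2 * ((Real.pi ^ ((d : ℝ) / 2) : ℝ) : ℂ) * (1 / 2) ^ l *
        (besS ((d : ℝ) / 2 + l + 1) (qq ζ / 4) * (dotc ζ x / 2) * legHom d l (dotc ζ x) (qq ζ) +
        besS ((d : ℝ) / 2 + l) (qq ζ / 4) * (l * legHom d (l - 1) (dotc ζ x) (qq ζ))) := by
    intro l ih ζ
    have h1 := wInt_hasDerivAt (legPoly d l) ζ x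
    simp only [ih, shift_q, shift_u] at h1
    exact h1.unique ((closed_hasDerivAt d hd l (dotc ζ x) (qq ζ)).const_mul _)
  induction l using Nat.twoStepInduction with
  | zero =>
    intro ζ
    have := sphere_exp hd ζ
    simp only [wInt, legPoly, legHom, qq]
    simpa using this
  | one =>
    intro ζ
    have h0 := step 0 (by
      intro ζ
      have := sphere_exp hd ζ
      simp only [wInt, legPoly, legHom, qq]
      simpa using this) ζ
    simp [legPoly, legHom] at h0 ⊢
    rw [h0]
    ring
  | more l ih0 ih1 =>
    intro ζ
    have hX := step (l + 1) ih1 ζ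
    have hr := wInt_rec hd l ζ x
    rw [hX, ih0 ζ] at hr
    have hL := legHom_rec d hd l (dotc ζ x) (qq ζ)
    have hν : (1 : ℝ) ≤ (d : ℝ) / 2 + l := by
      have : (2 : ℝ) ≤ d := by exact_mod_cast hd
      have : (0 : ℝ) ≤ l := Nat.cast_nonneg l
      linarith
    have hB := besS_rec _ hν (qq ζ / 4)
    apply mul_left_cancel₀ (den_ne d hd l)
    rw [hr]
    simp only [Nat.add_sub_cancel]
    have c1 : (d : ℝ) / 2 + ((l + 1 : ℕ) : ℝ) = (d : ℝ) / 2 + l + 1 := by push_cast; ring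
    have c2 : (d : ℝ) / 2 + ((l + 2 : ℕ) : ℝ) = (d : ℝ) / 2 + l + 2 := by push_cast; ring
    have c3 : (d : ℝ) / 2 + l + 1 + 1 = (d : ℝ) / 2 + l + 2 := by ring
    rw [c1, c2, c3]
    push_cast at hB ⊢
    generalize besS ((d : ℝ) / 2 + l) (qq ζ / 4) = B0 at *
    generalize besS ((d : ℝ) / 2 + l + 1) (qq ζ / 4) = B1 at *
    generalize besS ((d : ℝ) / 2 + l + 2) (qq ζ / 4) = B2 at *
    generalize legHom d (l + 2) (dotc ζ x) (qq ζ) = L2 at *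
    generalize legHom d (l + 1) (dotc ζ x) (qq ζ) = L1 at *
    generalize legHom d l (dotc ζ x) (qq ζ) = L0 at *
    generalize ((Real.pi ^ ((d : ℝ) / 2) : ℝ) : ℂ) = C at *
    generalize dotc ζ (x : EuclideanSpace ℝ (Fin d)) = u at *
    generalize qq ζ = q at *
    linear_combination (-2 * C * (1 / 2) ^ l * (l + 1) * L0) * hB -
      (1 / 2 * C * (1 / 2) ^ l * B2) * hL

lemma sqrt_arg (q w : ℂ) (hq : q ≠ 0) (hw : w = q ^ (1 / 2 : ℂ)) :
    w ^ 2 = q ∧ w ≠ 0 ∧ (w / 2).arg ≠ Real.pi := by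
  have h2 : w ^ 2 = q := by
    rw [hw, ← Complex.cpow_nat_mul]
    norm_num
  have h0 : w ≠ 0 := by
    rintro rfl
    exact hq (by simpa using h2.symm)
  refine ⟨h2, h0, fun h => ?_⟩
  have hre : 0 ≤ w.re := by
    rw [hw, Complex.cpow_def_of_ne_zero hq, Complex.exp_re]
    apply mul_nonneg (Real.exp_pos _).le
    have e : (Complex.log q * (1 / 2)).im = q.arg / 2 := by
      rw [show Complex.log q * (1 / 2) = Complex.log q * ((1 / 2 : ℝ) : ℂ) by push_cast; rfl,
        Complex.im_mul_ofReal, Complex.log_im]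
      ring
    rw [e]
    apply Real.cos_nonneg_of_mem_Icc
    have := Complex.neg_pi_lt_arg q
    have := Complex.arg_le_pi q
    constructor <;> linarith
  rw [Complex.arg_eq_pi_iff] at h
  have h1 := h.1
  have : (w / 2).re = w.re / 2 := by simp
  rw [this] at h1
  linarith

lemma besselI_eq (d ℓ : ℕ) (q w : ℂ) (hq : q ≠ 0) (hw : w = q ^ (1 / 2 : ℂ)) :
    (2 / w) ^ (((d : ℂ) - 2) / 2) * besselI ((ℓ : ℂ) + ((d : ℂ) - 2) / 2) w =
      (1 / 2) ^ ℓ * w ^ ℓ * besS ((d : ℝ) / 2 + ℓ) (q / 4) := by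
  obtain ⟨h2, h0, harg⟩ := sqrt_arg q w hq hw
  have hw2 : w / 2 ≠ 0 := div_ne_zero h0 two_ne_zero
  have e1 : (2 / w) ^ (((d : ℂ) - 2) / 2) = ((w / 2) ^ (((d : ℂ) - 2) / 2))⁻¹ := by
    rw [← Complex.inv_cpow _ _ harg, inv_div]
  have hne : (w / 2) ^ (((d : ℂ) - 2) / 2) ≠ 0 := by
    rw [Complex.cpow_def_of_ne_zero hw2]
    exact Complex.exp_ne_zero _
  rw [e1, inv_mul_eq_iff_eq_mul₀ hne, besselI, besS, ← tsum_mul_left, ← tsum_mul_left]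
  apply tsum_congr
  intro n
  have e2 : (w / 2) ^ ((ℓ : ℂ) + ((d : ℂ) - 2) / 2 + 2 * (n : ℂ)) =
      (w / 2) ^ (((d : ℂ) - 2) / 2) * ((1 / 2) ^ ℓ * w ^ ℓ * (q / 4) ^ n) := by
    rw [show (ℓ : ℂ) + ((d : ℂ) - 2) / 2 + 2 * (n : ℂ) =
      ((d : ℂ) - 2) / 2 + ((ℓ + 2 * n : ℕ) : ℂ) by push_cast; ring,
      Complex.cpow_add _ _ hw2, Complex.cpow_natCast, pow_add, pow_mul, ← h2]
    congr 2
    · rw [← mul_pow]; congr 1; ring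
    · congr 1; ring
  have e3 : Complex.Gamma ((ℓ : ℂ) + ((d : ℂ) - 2) / 2 + (n : ℂ) + 1) =
      (Real.Gamma ((d : ℝ) / 2 + ℓ + n) : ℂ) := by
    rw [← Complex.Gamma_ofReal]
    congr 1
    push_cast
    ring
  rw [e2, e3]
  ring

/-- explicit formula for the projection of `e_ζ` onto degree-ℓ spherical
harmonics, for `ζ·ζ ≠ 0` and `w = √(ζ·ζ)`. -/
theorem projection_exponential (d : ℕ) (hd : 2 ≤ d) (ℓ : ℕ)
    (P : Polynomial ℂ) (hP : IsLegendre d ℓ P)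
    (ζ : Fin d → ℂ) (hζ : ∑ i, ζ i * ζ i ≠ 0)
    (w : ℂ) (hw : w = (∑ i, ζ i * ζ i) ^ (1/2 : ℂ))
    (x : Metric.sphere (0 : EuclideanSpace ℝ (Fin d)) 1) :
    projector d ℓ P (expFun d ζ) x =
      (Real.Gamma ((d : ℝ) / 2) : ℂ) * (Nld d ℓ : ℂ) *
        (2 / w) ^ (((d : ℂ) - 2) / 2) * besselI ((ℓ : ℂ) + ((d : ℂ) - 2) / 2) w *
        P.eval ((∑ i, ((x : EuclideanSpace ℝ (Fin d)) i : ℂ) * ζ i) / w) := by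
  have hPl := eq_legPoly d hd ℓ P hP
  obtain ⟨h2, h0, -⟩ := sqrt_arg _ w hζ hw
  have hB := besselI_eq d ℓ _ w hζ hw
  have hF := wInt_formula hd x ℓ ζ
  have hu : ∑ i, ((x : EuclideanSpace ℝ (Fin d)) i : ℂ) * ζ i =
      dotc ζ (x : EuclideanSpace ℝ (Fin d)) :=
    Finset.sum_congr rfl fun i _ => mul_comm _ _
  have hH := legHom_eq d (dotc ζ (x : EuclideanSpace ℝ (Fin d))) w h0 ℓ
  have hpi : ((Real.pi ^ ((d : ℝ) / 2) : ℝ) : ℂ) ≠ 0 := by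
    exact_mod_cast (Real.rpow_pos_of_pos Real.pi_pos _).ne'
  have hG : (Real.Gamma ((d : ℝ) / 2) : ℂ) ≠ 0 := by
    have hdpos : (0 : ℝ) < (d : ℝ) / 2 := by
      have : (2 : ℝ) ≤ d := by exact_mod_cast hd
      linarith
    exact_mod_cast (Real.Gamma_pos_of_pos hdpos).ne'
  have hproj : projector d ℓ P (expFun d ζ) x =
      ((Nld d ℓ : ℂ) / (sphereArea d : ℂ)) * wInt d (legPoly d ℓ) ζ x := by
    rw [hPl]; rfl
  have hq : qq ζ = w ^ 2 := h2.symm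
  have hq' : ∑ i, ζ i * ζ i = w ^ 2 := h2.symm
  rw [hq] at hF
  rw [hq'] at hB
  have hR : (Real.Gamma ((d : ℝ) / 2) : ℂ) * (Nld d ℓ : ℂ) *
        (2 / w) ^ (((d : ℂ) - 2) / 2) * besselI ((ℓ : ℂ) + ((d : ℂ) - 2) / 2) w *
        P.eval ((∑ i, ((x : EuclideanSpace ℝ (Fin d)) i : ℂ) * ζ i) / w) =
      (Real.Gamma ((d : ℝ) / 2) : ℂ) * (Nld d ℓ : ℂ) * ((1 / 2) ^ ℓ *
        besS ((d : ℝ) / 2 + ℓ) (w ^ 2 / 4) * legHom d ℓ (dotc ζ x) (w ^ 2)) := by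
    rw [← hH, hu, hPl, mul_assoc ((Real.Gamma ((d : ℝ) / 2) : ℂ) * (Nld d ℓ : ℂ)), hB]
    ring
  rw [hproj, hR, hF, sphereArea, Complex.ofReal_div, Complex.ofReal_mul]
  rw [Complex.ofReal_ofNat]
  field_simp
end

section
/- Let d ≥ 2 be an integer, ℓ ∈ ℕ₀, and let p be a homogeneous polynomial of degree ℓ in d variables with complex coefficients which is harmonic, i.e. ∑_{i=1}^d ∂²p/∂x_i² = 0. Then for every z ∈ ℂ^d: ∫_{S^{d−1}} p(y) (y·z)^ℓ dσ(y) = (2^{1−ℓ} π^{d/2} ℓ! / Γ(ℓ + d/2)) · p(z), where p(z) denotes the evaluation of the polynomial p at the complex point z. -/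
open MeasureTheory

noncomputable section

namespace HPR

open Set MvPolynomial

variable {d : ℕ}

abbrev E (d : ℕ) := EuclideanSpace ℝ (Fin d)

/-- evaluation at a real point -/
def ev (p : MvPolynomial (Fin d) ℂ) (x : E d) : ℂ :=
  MvPolynomial.eval (fun i => ((x i : ℝ) : ℂ)) p

/-- Gaussian -/
def gs (x : E d) : ℂ := ((Real.exp (-‖x‖ ^ 2) : ℝ) : ℂ)

lemma ev_add (p q : MvPolynomial (Fin d) ℂ) (x : E d) : ev (p + q) x = ev p x + ev q x := by
  simp [ev]

lemma ev_mul (p q : MvPolynomial (Fin d) ℂ) (x : E d) : ev (p * q) x = ev p x * ev q x := by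
  simp [ev]

lemma ev_X (i : Fin d) (x : E d) : ev (X i) x = ((x i : ℝ) : ℂ) := by
  simp [ev]

lemma ev_C (a : ℂ) (x : E d) : ev (C a) x = a := by
  simp [ev]

lemma continuous_ev (p : MvPolynomial (Fin d) ℂ) : Continuous (ev p) := by
  unfold ev
  exact (MvPolynomial.continuous_eval p).comp (by fun_prop)

lemma continuous_gs : Continuous (gs (d := d)) := by
  unfold gs
  fun_prop

lemma ev_bound (p : MvPolynomial (Fin d) ℂ) :
    ∀ ε : ℝ, 0 < ε → ∃ K : ℝ, 0 ≤ K ∧ ∀ x : E d, ‖ev p x‖ ≤ K * Real.exp (ε * ‖x‖ ^ 2) := by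
  induction p using MvPolynomial.induction_on with
  | C a =>
    intro ε hε
    refine ⟨‖a‖, norm_nonneg _, fun x => ?_⟩
    rw [ev_C]
    have : 1 ≤ Real.exp (ε * ‖x‖ ^ 2) := Real.one_le_exp (by positivity)
    nlinarith [norm_nonneg a]
  | add p q hp hq =>
    intro ε hε
    obtain ⟨K, hK, h1⟩ := hp ε hε
    obtain ⟨M, hM, h2⟩ := hq ε hε
    refine ⟨K + M, by positivity, fun x => ?_⟩
    rw [ev_add, add_mul]
    exact (norm_add_le _ _).trans (add_le_add (h1 x) (h2 x))
  | mul_X p i hp =>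
    intro ε hε
    obtain ⟨K, hK, h1⟩ := hp (ε / 2) (by positivity)
    refine ⟨K * (1 + 2 / ε), by positivity, fun x => ?_⟩
    rw [ev_mul, norm_mul, ev_X, Complex.norm_real]
    have h3 : ‖x i‖ ≤ ‖x‖ := PiLp.norm_apply_le x i
    have h4 : ‖x‖ ≤ (1 + 2 / ε) * Real.exp (ε / 2 * ‖x‖ ^ 2) := by
      have h5 : ε / 2 * ‖x‖ ^ 2 + 1 ≤ Real.exp (ε / 2 * ‖x‖ ^ 2) := Real.add_one_le_exp _
      have h6 : ‖x‖ ≤ (1 + 2 / ε) * (ε / 2 * ‖x‖ ^ 2 + 1) := by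
        have : (1 + 2 / ε) * (ε / 2 * ‖x‖ ^ 2 + 1)
          = ‖x‖ ^ 2 + 1 + (ε / 2 * ‖x‖ ^ 2 + 2 / ε) := by field_simp; ring
        rw [this]
        have : 0 ≤ ε / 2 * ‖x‖ ^ 2 + 2 / ε := by positivity
        nlinarith [sq_nonneg (‖x‖ - 1)]
      exact h6.trans (mul_le_mul_of_nonneg_left h5 (by positivity))
    calc ‖ev p x‖ * ‖x i‖ ≤ (K * Real.exp (ε / 2 * ‖x‖ ^ 2)) *
          ((1 + 2 / ε) * Real.exp (ε / 2 * ‖x‖ ^ 2)) :=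
          mul_le_mul (h1 x) (h3.trans h4) (norm_nonneg _) (by positivity)
      _ = K * (1 + 2 / ε) * Real.exp (ε * ‖x‖ ^ 2) := by
          rw [show ε * ‖x‖ ^ 2 = ε / 2 * ‖x‖ ^ 2 + ε / 2 * ‖x‖ ^ 2 by ring, Real.exp_add]; ring

lemma integrable_gauss : Integrable (fun x : E d => Real.exp (-(1 / 2) * ‖x‖ ^ 2)) := by
  have h := GaussianFourier.integrable_cexp_neg_mul_sq_norm_add (V := E d)
    (b := ((1 / 2 : ℝ) : ℂ)) (by simp) 0 0
  refine h.norm.congr (Filter.Eventually.of_forall fun x => ?_)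
  simp only [Complex.norm_exp]
  congr 1
  rw [show -(((1 / 2 : ℝ)) : ℂ) * (‖x‖ : ℂ) ^ 2 + 0 * ((inner ℝ (0 : E d) x : ℝ) : ℂ)
    = ((-(1 / 2) * ‖x‖ ^ 2 : ℝ) : ℂ) by push_cast; ring, Complex.ofReal_re]

lemma integrable_ev (p : MvPolynomial (Fin d) ℂ) : Integrable (fun x : E d => ev p x * gs x) := by
  obtain ⟨K, hK, h⟩ := ev_bound p (1 / 2) (by norm_num)
  refine Integrable.mono' (integrable_gauss.const_mul K)
    ((continuous_ev p).mul continuous_gs).aestronglyMeasurable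
    (Filter.Eventually.of_forall fun x => ?_)
  rw [norm_mul, gs, Complex.norm_real, Real.norm_eq_abs, Real.abs_exp]
  calc _ ≤ (K * Real.exp (1 / 2 * ‖x‖ ^ 2)) * Real.exp (-‖x‖ ^ 2) :=
        mul_le_mul_of_nonneg_right (h x) (Real.exp_pos _).le
    _ = _ := by rw [mul_assoc, ← Real.exp_add]; congr 2; ring

/-- Gaussian functional -/
def G : MvPolynomial (Fin d) ℂ →ₗ[ℂ] ℂ where
  toFun p := ∫ x : E d, ev p x * gs x
  map_add' p q := by
    simp only [ev_add, add_mul]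
    exact integral_add (integrable_ev p) (integrable_ev q)
  map_smul' c p := by
    simp only [MvPolynomial.smul_eq_C_mul, ev_mul, ev_C, mul_assoc, RingHom.id_apply, smul_eq_mul]
    exact integral_const_mul _ _

lemma G_apply (p : MvPolynomial (Fin d) ℂ) : G p = ∫ x : E d, ev p x * gs x := rfl

lemma coord_hasDeriv (i j : Fin d) (x : E d) :
    HasDerivAt (fun t : ℝ => (((x + t • EuclideanSpace.single i (1 : ℝ)) j : ℝ) : ℂ))
      (if i = j then 1 else 0) 0 := by
  by_cases h : i = j
  · subst h
    simpa using ((Complex.ofRealCLM.hasDerivAt (x := (0 : ℝ))).const_add ((x i : ℝ) : ℂ))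
  · have : j ≠ i := Ne.symm h
    simpa [h, this] using hasDerivAt_const (0 : ℝ) ((x j : ℝ) : ℂ)

lemma ev_hasLineDeriv (p : MvPolynomial (Fin d) ℂ) (i : Fin d) (x : E d) :
    HasLineDerivAt ℝ (ev p) (ev (pderiv i p) x) x (EuclideanSpace.single i (1 : ℝ)) := by
  unfold HasLineDerivAt
  induction p using MvPolynomial.induction_on with
  | C a => simpa [ev_C, ev] using hasDerivAt_const (0 : ℝ) a
  | add p q hp hq =>
    simp only [map_add, ev_add]
    exact hp.add hq
  | mul_X p j hp =>
    simp only [ev_mul, ev_X, Derivation.leibniz, ev_add, smul_eq_mul, pderiv_X]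
    have := hp.mul (coord_hasDeriv i j x)
    refine this.congr_deriv ?_
    simp only [zero_smul, add_zero]
    by_cases h : i = j
    · subst h
      simp [ev]; ring
    · have : j ≠ i := Ne.symm h
      simp [ev, h, this]; ring

lemma gs_hasLineDeriv (i : Fin d) (x : E d) :
    HasLineDerivAt ℝ gs (-2 * ((x i : ℝ) : ℂ) * gs x) x (EuclideanSpace.single i (1 : ℝ)) := by
  unfold HasLineDerivAt gs
  have h1 : HasDerivAt (fun t : ℝ => x + t • EuclideanSpace.single i (1 : ℝ))
      (EuclideanSpace.single i (1 : ℝ)) 0 := by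
    simpa using ((hasDerivAt_id (0 : ℝ)).smul_const (EuclideanSpace.single i (1 : ℝ))).const_add x
  have h2 := (h1.norm_sq.neg.exp).ofReal_comp
  refine h2.congr_deriv ?_
  simp [EuclideanSpace.inner_single_right]
  ring

lemma G_X_mul (i : Fin d) (p : MvPolynomial (Fin d) ℂ) :
    G (X i * p) = (1 / 2) * G (pderiv i p) := by
  have h := integral_bilinear_hasLineDerivAt_right_eq_neg_left_of_integrable
    (μ := (volume : Measure (E d))) (f := ev p) (f' := ev (pderiv i p)) (g := gs)
    (g' := fun x => -2 * ((x i : ℝ) : ℂ) * gs x) (v := EuclideanSpace.single i (1 : ℝ))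
    (B := ContinuousLinearMap.mul ℝ ℂ)
    (by simpa using integrable_ev (pderiv i p))
    (by
      have := integrable_ev (C (-2) * (X i * p))
      simp only [ev_mul, ev_X, ev_C] at this
      refine this.congr (Filter.Eventually.of_forall fun x => ?_)
      simp only [ContinuousLinearMap.mul_apply']
      ring)
    (by simpa using integrable_ev p)
    (fun x _ => ev_hasLineDeriv p i x) (fun x _ => gs_hasLineDeriv i x)
  simp only [ContinuousLinearMap.mul_apply'] at h
  rw [← G_apply] at h
  have h2 : ∫ x : E d, ev p x * (-2 * ((x i : ℝ) : ℂ) * gs x) = -2 * G (X i * p) := by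
    rw [G_apply, ← integral_const_mul]
    congr 1
    ext x
    rw [ev_mul, ev_X]; ring
  rw [h2] at h
  linear_combination (-1 / 2) * h

lemma G_one : G (1 : MvPolynomial (Fin d) ℂ) = ((Real.pi ^ ((d : ℝ) / 2) : ℝ) : ℂ) := by
  have h := GaussianFourier.integral_rexp_neg_mul_sq_norm (V := E d) (b := 1) one_pos
  simp only [div_one, finrank_euclideanSpace_fin] at h
  rw [← h, G_apply, ← integral_complex_ofReal]
  congr 1
  ext x
  simp [ev, gs]

lemma pderiv_comm (i j : Fin d) (p : MvPolynomial (Fin d) ℂ) :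
    pderiv i (pderiv j p) = pderiv j (pderiv i p) := by
  have : ⁅(pderiv i : Derivation ℂ (MvPolynomial (Fin d) ℂ) (MvPolynomial (Fin d) ℂ)), (pderiv j : Derivation ℂ (MvPolynomial (Fin d) ℂ) (MvPolynomial (Fin d) ℂ))⁆ = 0 := by
    apply MvPolynomial.derivation_ext
    intro k
    classical
    simp only [Derivation.commutator_apply, pderiv_X, Pi.single_apply, Derivation.zero_apply]
    split_ifs <;> simp
  have h := DFunLike.congr_fun this p
  rw [Derivation.commutator_apply] at h
  exact sub_eq_zero.mp h

def L (z : Fin d → ℂ) : MvPolynomial (Fin d) ℂ := ∑ i, X i * C (z i)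

lemma pderiv_L (z : Fin d → ℂ) (i : Fin d) : pderiv i (L z) = C (z i) := by
  classical
  simp [L, pderiv_X, Pi.single_apply, Derivation.leibniz]

lemma G_harm (z : Fin d → ℂ) (k : ℕ) : ∀ p : MvPolynomial (Fin d) ℂ, p.IsHomogeneous k →
    ∑ i : Fin d, pderiv i (pderiv i p) = 0 →
    G (p * L z ^ k) = (1 / 2) ^ k * (k.factorial : ℂ) * eval z p * G (1 : MvPolynomial (Fin d) ℂ) := by
  induction k with
  | zero =>
    intro p hp _
    obtain ⟨c, rfl⟩ : ∃ c, p = C c := ⟨_, MvPolynomial.totalDegree_eq_zero_iff_eq_C.mp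
      (Nat.le_zero.mp hp.totalDegree_le)⟩
    rw [pow_zero, mul_one, ← mul_one (C c), ← smul_eq_C_mul, map_smul]
    simp
  | succ k ih =>
    intro p hp hh
    have hE := hp.sum_X_mul_pderiv
    have hk : ((k + 1 : ℕ) : ℂ) ≠ 0 := by exact_mod_cast Nat.succ_ne_zero k
    have hq : ∀ i, G (pderiv i p * L z ^ k) =
        (1 / 2) ^ k * (k.factorial : ℂ) * eval z (pderiv i p) * G (1 : MvPolynomial (Fin d) ℂ) := by
      intro i
      refine ih _ (by simpa using hp.pderiv (i := i)) ?_
      have : ∑ j, pderiv j (pderiv j (pderiv i p)) = pderiv i (∑ j, pderiv j (pderiv j p)) := by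
        rw [map_sum]
        refine Finset.sum_congr rfl fun j _ => ?_
        rw [pderiv_comm j i p, pderiv_comm j i]
      rw [this, hh, map_zero]
    have hev : ∑ i, z i * eval z (pderiv i p) = ((k + 1 : ℕ) : ℂ) * eval z p := by
      have := congrArg (eval z) hE
      simpa using this
    have key : ((k + 1 : ℕ) : ℂ) * G (p * L z ^ (k + 1)) =
        (1 / 2) * (((k + 1 : ℕ) : ℂ) * ∑ i, z i * G (pderiv i p * L z ^ k)) := by
      have e1 : ((k + 1 : ℕ) : ℂ) * G (p * L z ^ (k + 1)) =
          G (∑ i, X i * (pderiv i p * L z ^ (k + 1))) := by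
        rw [← smul_eq_mul, ← map_smul]
        congr 1
        simp only [← mul_assoc]
        rw [← Finset.sum_mul, hE, ← smul_mul_assoc, Nat.cast_smul_eq_nsmul]
      have e2 : ∀ i, pderiv i (pderiv i p * L z ^ (k + 1)) =
          pderiv i (pderiv i p) * L z ^ (k + 1) +
            (((k + 1 : ℕ) : ℂ) * z i) • (pderiv i p * L z ^ k) := by
        intro i
        rw [pderiv_mul, pderiv_pow, pderiv_L, smul_eq_C_mul]
        simp only [Nat.add_sub_cancel, map_mul, map_natCast]
        ring
      rw [e1, map_sum]
      simp only [G_X_mul, e2, map_add, map_smul, smul_eq_mul]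
      rw [← Finset.mul_sum, Finset.sum_add_distrib, ← map_sum, ← Finset.sum_mul, hh]
      simp only [zero_mul, map_zero, zero_add, mul_assoc, ← Finset.mul_sum]
    have e3 : ∑ i, z i * G (pderiv i p * L z ^ k) =
        (1 / 2) ^ k * (k.factorial : ℂ) * G (1 : MvPolynomial (Fin d) ℂ) *
          (((k + 1 : ℕ) : ℂ) * eval z p) := by
      rw [← hev, Finset.mul_sum]
      refine Finset.sum_congr rfl fun i _ => ?_
      rw [hq]; ring
    rw [e3] at key
    refine mul_left_cancel₀ hk (key.trans ?_)
    rw [Nat.factorial_succ, pow_succ]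
    push_cast
    ring

lemma polar (hd : 1 ≤ d) (n : ℕ) (f : E d → ℂ)
    (hf : ∀ (r : ℝ) (y : E d), f (r • y) = (r : ℂ) ^ n * f y) :
    ∫ x : E d, f x * gs x =
      (∫ y : Metric.sphere (0 : E d) 1, f y ∂(volume : Measure (E d)).toSphere) *
        ((1 / 2 * Real.Gamma (((n + d : ℕ) : ℝ) / 2) : ℝ) : ℂ) := by
  set g : ℝ → ℂ := fun r => (r : ℂ) ^ n * ((Real.exp (-r ^ 2) : ℝ) : ℂ) with hg
  have hR : ∫ r : Ioi (0 : ℝ), g r ∂(Measure.volumeIoiPow (d - 1)) =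
      ((1 / 2 * Real.Gamma (((n + d : ℕ) : ℝ) / 2) : ℝ) : ℂ) := by
    have h1 := integral_rpow_mul_exp_neg_rpow (p := 2) (q := ((n + d - 1 : ℕ) : ℝ)) two_pos
      (lt_of_lt_of_le (by norm_num) (Nat.cast_nonneg _))
    have h2 : (((n + d - 1 : ℕ) : ℝ) + 1) = ((n + d : ℕ) : ℝ) := by
      rw [Nat.cast_sub (by omega)]; push_cast; ring
    rw [h2] at h1
    rw [← h1, ← integral_complex_ofReal]
    simp only [Measure.volumeIoiPow, ENNReal.ofReal]
    rw [integral_withDensity_eq_integral_smul,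
        integral_subtype_comap measurableSet_Ioi fun a ↦ Real.toNNReal (a ^ (d - 1)) • g a,
        setIntegral_congr_fun measurableSet_Ioi fun x hx ↦ ?_]
    · have hx0 : (0 : ℝ) < x := hx
      simp only [hg]
      rw [NNReal.smul_def, Real.coe_toNNReal _ (pow_nonneg hx0.le _), Real.rpow_natCast,
        show n + d - 1 = (d - 1) + n by omega, pow_add, Complex.real_smul]
      norm_num
      ring
    · exact (measurable_subtype_coe.pow_const _).real_toNNReal
  have hmp := (volume : Measure (E d)).measurePreserving_homeomorphUnitSphereProd
  rw [finrank_euclideanSpace_fin] at hmp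
  have : Nonempty (Fin d) := ⟨⟨0, hd⟩⟩
  calc ∫ x : E d, f x * gs x
      = ∫ x : ({(0)}ᶜ : Set (E d)), f x * gs x.1 ∂((volume : Measure (E d)).comap (↑)) := by
        rw [integral_subtype_comap (measurableSet_singleton _).compl fun x ↦ f x * gs x,
          restrict_compl_singleton]
    _ = ∫ x, f x.1 * g x.2 ∂(volume : Measure (E d)).toSphere.prod (.volumeIoiPow (d - 1)) := by
        rw [← hmp.integral_comp (Homeomorph.measurableEmbedding _)
          (fun x => f x.1 * g x.2)]
        congr 1
        ext x
        have hx : ‖(x : E d)‖ ≠ 0 := norm_ne_zero_iff.mpr x.2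
        simp only [hg, homeomorphUnitSphereProd_apply_fst_coe, homeomorphUnitSphereProd_apply_snd_coe, gs]
        rw [show f (x : E d) = f (‖(x : E d)‖ • (‖(x : E d)‖⁻¹ • (x : E d))) by
          rw [smul_smul, mul_inv_cancel₀ hx, one_smul], hf]
        ring
    _ = (∫ y : Metric.sphere (0 : E d) 1, f y ∂(volume : Measure (E d)).toSphere) *
          ∫ r : Ioi (0 : ℝ), g r ∂(Measure.volumeIoiPow (d - 1)) :=
        integral_prod_mul (fun y : Metric.sphere (0 : E d) 1 => f y) (fun r : Ioi (0 : ℝ) => g r)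
    _ = _ := by rw [hR]

lemma ev_smul {n : ℕ} {p : MvPolynomial (Fin d) ℂ} (hp : p.IsHomogeneous n) (r : ℝ) (y : E d) :
    ev p (r • y) = (r : ℂ) ^ n * ev p y := by
  unfold ev
  rw [MvPolynomial.eval_eq, MvPolynomial.eval_eq, Finset.mul_sum]
  refine Finset.sum_congr rfl fun m hm => ?_
  have h := hp (MvPolynomial.mem_support_iff.mp hm)
  have hsum : ∑ i ∈ m.support, m i = n := by
    rw [← h]; simp [Finsupp.weight_apply, Finsupp.sum]
  simp only [PiLp.smul_apply, smul_eq_mul, Complex.ofReal_mul, mul_pow, Finset.prod_mul_distrib,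
    Finset.prod_pow_eq_pow_sum, hsum]
  ring

end HPR

end

/-- for a harmonic homogeneous polynomial `p` of degree ℓ in `d` variables,
`∫_{S^{d−1}} p(y) (y·z)^ℓ dσ(y) = (2^{1−ℓ} π^{d/2} ℓ!/Γ(ℓ+d/2)) p(z)` for all `z ∈ ℂ^d`. -/
theorem harmonic_polynomial_reproducing (d : ℕ) (hd : 2 ≤ d) (ℓ : ℕ)
    (p : MvPolynomial (Fin d) ℂ) (hhom : p.IsHomogeneous ℓ)
    (hharm : ∑ i : Fin d, MvPolynomial.pderiv i (MvPolynomial.pderiv i p) = 0)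
    (z : Fin d → ℂ) :
    ∫ y, (MvPolynomial.eval (fun i => (((y : EuclideanSpace ℝ (Fin d)) i : ℝ) : ℂ)) p *
        (∑ i, ((y : EuclideanSpace ℝ (Fin d)) i : ℂ) * z i) ^ ℓ) ∂ sphMeasure d =
      (((2 : ℝ) ^ ((1 : ℝ) - (ℓ : ℝ)) * Real.pi ^ ((d : ℝ) / 2) * (ℓ.factorial : ℝ) /
          Real.Gamma ((ℓ : ℝ) + (d : ℝ) / 2) : ℝ) : ℂ) * MvPolynomial.eval z p := by
  obtain ⟨hd1, hd0⟩ : 1 ≤ d ∧ 0 < (d : ℝ) := ⟨by omega, by exact_mod_cast (by omega : 0 < d)⟩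
  have hL : (HPR.L z).IsHomogeneous 1 := by
    unfold HPR.L
    refine MvPolynomial.IsHomogeneous.sum _ _ _ fun i _ => ?_
    simpa using (MvPolynomial.isHomogeneous_X ℂ i).mul (MvPolynomial.isHomogeneous_C (Fin d) (z i))
  have hq : (p * HPR.L z ^ ℓ).IsHomogeneous (ℓ + ℓ) := by
    simpa using hhom.mul (hL.pow ℓ)
  have h1 := HPR.polar hd1 (ℓ + ℓ) (HPR.ev (p * HPR.L z ^ ℓ)) (HPR.ev_smul hq)
  rw [← HPR.G_apply, HPR.G_harm z ℓ p hhom hharm, HPR.G_one] at h1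
  have h2 : ∀ y : EuclideanSpace ℝ (Fin d), HPR.ev (p * HPR.L z ^ ℓ) y =
      MvPolynomial.eval (fun i => ((y i : ℝ) : ℂ)) p * (∑ i, (y i : ℂ) * z i) ^ ℓ := by
    intro y
    simp [HPR.ev, HPR.L]
  simp only [h2] at h1
  have hc : (((ℓ + ℓ + d : ℕ) : ℝ) / 2) = (ℓ : ℝ) + (d : ℝ) / 2 := by push_cast; ring
  rw [hc] at h1
  have hG : Real.Gamma ((ℓ : ℝ) + (d : ℝ) / 2) ≠ 0 := (Real.Gamma_pos_of_pos (by positivity)).ne'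
  have hGC : ((Real.Gamma ((ℓ : ℝ) + (d : ℝ) / 2) : ℝ) : ℂ) ≠ 0 := by exact_mod_cast hG
  have h2p : (2 : ℝ) ^ ((1 : ℝ) - (ℓ : ℝ)) = 2 * (1 / 2) ^ ℓ := by
    rw [Real.rpow_sub two_pos, Real.rpow_one, Real.rpow_natCast, one_div, inv_pow, div_eq_mul_inv]
  rw [h2p]
  unfold sphMeasure
  generalize Real.Gamma ((ℓ : ℝ) + (d : ℝ) / 2) = Γ at *
  refine mul_right_cancel₀ hGC ?_
  push_cast at h1 ⊢
  field_simp at h1 ⊢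
  linear_combination (-1) * h1
end

section
/- Let d ≥ 2 be an integer, ℓ ∈ ℕ₀, and let κ ≤ 0 be a real number; write √κ := i√(−κ). Then ∫_{B^d} |φ_ℓ(√κ |x|)|² dx ≤ |S^{d−1}| · |φ_ℓ(√κ)|² / (2(ℓ + ν_d + 1)), where B^d is the open unit ball of ℝ^d and |S^{d−1}| = 2π^{d/2}/Γ(d/2). -/
open MeasureTheory

noncomputable section

/-- The entire function φ_ℓ (with ν_d = (d-2)/2). -/
def phiF (d ℓ : ℕ) (z : ℂ) : ℂ :=
  z ^ ℓ / (2 : ℂ) ^ ((ℓ : ℂ) + ((d : ℂ) - 2) / 2) *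
    ∑' n : ℕ, ((-1 : ℂ) ^ n / ((n.factorial : ℂ) *
      Complex.Gamma ((ℓ : ℂ) + ((d : ℂ) - 2) / 2 + (n : ℂ) + 1))) * (z / 2) ^ (2 * n)

end

/-- Real coefficient of the series at imaginary arguments. -/
noncomputable def auxT (a t : ℝ) (n : ℕ) : ℝ :=
  (t / 2) ^ (2 * n) / ((n.factorial : ℝ) * Real.Gamma (a + n + 1))

lemma auxGamma (a : ℝ) (ha : 0 ≤ a) (n : ℕ) :
    Real.Gamma (a + 1) ≤ Real.Gamma (a + n + 1) := by
  induction n with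
  | zero => simp
  | succ k ih =>
    have h0 : 0 ≤ (k : ℝ) := Nat.cast_nonneg k
    have h := Real.Gamma_add_one (s := a + k + 1) (by positivity)
    have hp : 0 < Real.Gamma (a + k + 1) := Real.Gamma_pos_of_pos (by positivity)
    have e : a + ((k + 1 : ℕ) : ℝ) + 1 = a + k + 1 + 1 := by push_cast; ring
    rw [e, h]
    nlinarith

lemma auxT_nonneg (a t : ℝ) (ha : 0 ≤ a) (n : ℕ) : 0 ≤ auxT a t n := by
  unfold auxT
  have hp : 0 < Real.Gamma (a + n + 1) := Real.Gamma_pos_of_pos (by positivity)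
  have : 0 ≤ (t / 2) ^ (2 * n) := by rw [pow_mul]; positivity
  positivity

lemma auxT_summable (a t : ℝ) (ha : 0 ≤ a) : Summable (auxT a t) := by
  have hg : 0 < Real.Gamma (a + 1) := Real.Gamma_pos_of_pos (by positivity)
  refine Summable.of_nonneg_of_le (auxT_nonneg a t ha) (fun n => ?_)
    ((Real.summable_pow_div_factorial ((t / 2) ^ 2)).mul_right (1 / Real.Gamma (a + 1)))
  unfold auxT
  rw [pow_mul, div_mul_div_comm, mul_one]
  have := auxGamma a ha n
  gcongr

lemma aux_norm (d ℓ : ℕ) (hd : 2 ≤ d) (t : ℝ) (ht : 0 ≤ t) :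
    ‖phiF d ℓ (Complex.I * (t : ℂ))‖ =
      t ^ ℓ / ‖(2 : ℂ) ^ ((ℓ : ℂ) + ((d : ℂ) - 2) / 2)‖ *
        ∑' n, auxT ((ℓ : ℝ) + ((d : ℝ) - 2) / 2) t n := by
  have hd' : (2 : ℝ) ≤ d := by exact_mod_cast hd
  have ha : 0 ≤ (ℓ : ℝ) + ((d : ℝ) - 2) / 2 := by
    have : (0 : ℝ) ≤ ℓ := Nat.cast_nonneg _
    linarith
  have key : ∀ n : ℕ, ((-1 : ℂ) ^ n / ((n.factorial : ℂ) *
      Complex.Gamma ((ℓ : ℂ) + ((d : ℂ) - 2) / 2 + (n : ℂ) + 1))) *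
        ((Complex.I * (t : ℂ)) / 2) ^ (2 * n) =
      ((auxT ((ℓ : ℝ) + ((d : ℝ) - 2) / 2) t n : ℝ) : ℂ) := by
    intro n
    have e : ((ℓ : ℂ) + ((d : ℂ) - 2) / 2 + (n : ℂ) + 1) =
      (((ℓ : ℝ) + ((d : ℝ) - 2) / 2 + n + 1 : ℝ) : ℂ) := by push_cast; ring
    unfold auxT
    rw [e, Complex.Gamma_ofReal, mul_div_assoc, mul_pow, pow_mul Complex.I, Complex.I_sq]
    have h1 : ((-1 : ℂ) ^ n) * (-1) ^ n = 1 := by rw [← mul_pow]; simp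
    rw [Complex.ofReal_div, Complex.ofReal_mul, Complex.ofReal_pow, Complex.ofReal_div,
      Complex.ofReal_natCast, Complex.ofReal_ofNat]
    rw [div_mul_eq_mul_div, ← mul_assoc, h1, one_mul]
  unfold phiF
  rw [tsum_congr key, ← Complex.ofReal_tsum, norm_mul, norm_div, norm_pow, norm_mul,
    Complex.norm_I, one_mul, Complex.norm_real, Complex.norm_real, Real.norm_of_nonneg ht,
    Real.norm_of_nonneg (tsum_nonneg (auxT_nonneg _ t ha))]

lemma aux_le (d ℓ : ℕ) (hd : 2 ≤ d) (s r : ℝ) (hs : 0 ≤ s) (hr : 0 ≤ r) (hr1 : r ≤ 1) :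
    ‖phiF d ℓ (Complex.I * (s : ℂ) * (r : ℂ))‖ ≤ r ^ ℓ * ‖phiF d ℓ (Complex.I * (s : ℂ))‖ := by
  have hd' : (2 : ℝ) ≤ d := by exact_mod_cast hd
  have ha : 0 ≤ (ℓ : ℝ) + ((d : ℝ) - 2) / 2 := by
    have : (0 : ℝ) ≤ ℓ := Nat.cast_nonneg _
    linarith
  rw [mul_assoc, ← Complex.ofReal_mul, aux_norm d ℓ hd _ (mul_nonneg hs hr), aux_norm d ℓ hd s hs]
  have : ∑' n, auxT ((ℓ : ℝ) + ((d : ℝ) - 2) / 2) (s * r) n ≤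
      ∑' n, auxT ((ℓ : ℝ) + ((d : ℝ) - 2) / 2) s n := by
    refine Summable.tsum_le_tsum (fun n => ?_) (auxT_summable _ _ ha) (auxT_summable _ _ ha)
    unfold auxT
    have hp : 0 < Real.Gamma ((ℓ : ℝ) + ((d : ℝ) - 2) / 2 + n + 1) :=
      Real.Gamma_pos_of_pos (by positivity)
    gcongr
    exact mul_le_of_le_one_right hs hr1
  rw [mul_pow]
  calc _ ≤ s ^ ℓ * r ^ ℓ / ‖(2 : ℂ) ^ ((ℓ : ℂ) + ((d : ℂ) - 2) / 2)‖ *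
        ∑' n, auxT ((ℓ : ℝ) + ((d : ℝ) - 2) / 2) s n := by gcongr
    _ = _ := by ring

lemma aux_vol (d : ℕ) (hd : 2 ≤ d) :
    (d : ℝ) * (volume : Measure (EuclideanSpace ℝ (Fin d))).real (Metric.ball 0 1) =
      sphereArea d := by
  have : Nonempty (Fin d) := ⟨⟨0, by omega⟩⟩
  have hd0 : (0 : ℝ) < (d : ℝ) / 2 := by
    have : (2 : ℝ) ≤ d := by exact_mod_cast hd
    linarith
  have hg : 0 < Real.Gamma ((d : ℝ) / 2) := Real.Gamma_pos_of_pos hd0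
  rw [Measure.real, EuclideanSpace.volume_ball]
  have hpi : Real.sqrt Real.pi ^ d = Real.pi ^ ((d : ℝ) / 2) := by
    rw [Real.sqrt_eq_rpow, ← Real.rpow_natCast, ← Real.rpow_mul Real.pi_pos.le]
    congr 1; ring
  rw [Fintype.card_fin, hpi, Real.Gamma_add_one hd0.ne']
  simp only [ENNReal.ofReal_one, one_pow, one_mul]
  rw [ENNReal.toReal_ofReal (by positivity)]
  unfold sphereArea
  field_simp

lemma aux_int (d : ℕ) (hd : 2 ≤ d) (ℓ : ℕ) :
    ∫ x in Metric.ball (0 : EuclideanSpace ℝ (Fin d)) 1, ‖x‖ ^ (2 * ℓ) =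
      sphereArea d / (2 * ((ℓ : ℝ) + ((d : ℝ) - 2) / 2 + 1)) := by
  have : Nonempty (Fin d) := ⟨⟨0, by omega⟩⟩
  rw [← integral_indicator measurableSet_ball]
  have h := integral_fun_norm_addHaar (volume : Measure (EuclideanSpace ℝ (Fin d)))
    ((Set.Iio (1 : ℝ)).indicator (fun y => y ^ (2 * ℓ)))
  have e : (fun x : EuclideanSpace ℝ (Fin d) =>
      (Metric.ball (0 : EuclideanSpace ℝ (Fin d)) 1).indicator (fun x => ‖x‖ ^ (2 * ℓ)) x) =
      fun x => (Set.Iio (1 : ℝ)).indicator (fun y => y ^ (2 * ℓ)) ‖x‖ := by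
    funext x
    simp [Set.indicator]
  rw [e, h, finrank_euclideanSpace_fin, nsmul_eq_mul, smul_eq_mul, ← mul_assoc, aux_vol d hd]
  have e2 : (fun y : ℝ => y ^ (d - 1) • (Set.Iio (1 : ℝ)).indicator (fun y => y ^ (2 * ℓ)) y) =
      (Set.Iio (1 : ℝ)).indicator (fun y => y ^ (2 * ℓ + d - 1)) := by
    funext y
    simp only [Set.indicator, smul_eq_mul]
    split_ifs
    · rw [← pow_add]; congr 1; omega
    · simp
  rw [e2, setIntegral_indicator measurableSet_Iio, Set.Ioi_inter_Iio,
    ← integral_Ioc_eq_integral_Ioo, ← intervalIntegral.integral_of_le zero_le_one, integral_pow]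
  have e3 : 2 * ℓ + d - 1 + 1 = 2 * ℓ + d := by omega
  have e4 : ((2 * ℓ + d - 1 : ℕ) : ℝ) + 1 = 2 * ℓ + d := by exact_mod_cast e3
  rw [e4, e3, one_pow, zero_pow (by omega)]
  rw [div_eq_mul_inv (sphereArea d), sub_zero, one_div]
  congr 2
  ring

/-- for `κ ≤ 0` (with `√κ := i√(−κ)`),
`∫_{B^d} |φ_ℓ(√κ |x|)|² dx ≤ |S^{d−1}| |φ_ℓ(√κ)|² / (2(ℓ+ν_d+1))`. -/
theorem ball_integral_phi_bound (d : ℕ) (hd : 2 ≤ d) (ℓ : ℕ) (κ : ℝ) (hκ : κ ≤ 0) :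
    (∫ x in Metric.ball (0 : EuclideanSpace ℝ (Fin d)) 1,
        ‖phiF d ℓ (Complex.I * (Real.sqrt (-κ) : ℂ) * (‖x‖ : ℂ))‖ ^ 2) ≤
      sphereArea d * ‖phiF d ℓ (Complex.I * (Real.sqrt (-κ) : ℂ))‖ ^ 2 /
        (2 * ((ℓ : ℝ) + ((d : ℝ) - 2) / 2 + 1)) := by
  have h := aux_int d hd ℓ
  calc _ ≤ ∫ x in Metric.ball (0 : EuclideanSpace ℝ (Fin d)) 1,
        ‖x‖ ^ (2 * ℓ) * ‖phiF d ℓ (Complex.I * (Real.sqrt (-κ) : ℂ))‖ ^ 2 := by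
        refine integral_mono_of_nonneg (Filter.Eventually.of_forall fun x => by positivity) ?_ ?_
        · have hc : Continuous fun x : EuclideanSpace ℝ (Fin d) =>
            ‖x‖ ^ (2 * ℓ) * ‖phiF d ℓ (Complex.I * (Real.sqrt (-κ) : ℂ))‖ ^ 2 := by fun_prop
          exact (hc.continuousOn.integrableOn_compact (isCompact_closedBall 0 1)).mono_set
            Metric.ball_subset_closedBall
        · filter_upwards [ae_restrict_mem measurableSet_ball] with x hx
          have hx1 : ‖x‖ ≤ 1 := by simpa using (mem_ball_zero_iff.mp hx).le
          have := aux_le d ℓ hd (Real.sqrt (-κ)) ‖x‖ (Real.sqrt_nonneg _) (norm_nonneg _) hx1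
          calc _ ≤ (‖x‖ ^ ℓ * ‖phiF d ℓ (Complex.I * (Real.sqrt (-κ) : ℂ))‖) ^ 2 := by gcongr
            _ = _ := by rw [mul_pow, ← pow_mul, mul_comm ℓ 2]
    _ = _ := by
        rw [integral_mul_const, h]
        ring
end

section
/- Let κ ∈ ℂ \ {0} and let z ≥ 0 be a real number such that J_z(√κ) ≠ 0 (principal square root). Define u(t) := J_z(√κ e^{−t}) / J_z(√κ) for t ≥ 0. Then: (a) u is infinitely differentiable on [0,∞) with u(0) = 1; (b) u''(t) = (z² − κ e^{−2t}) u(t) for all t ≥ 0, i.e. u solves −u'' + Q_κ u = −z² u with Q_κ(t) := −κ e^{−2t}; (c) u'(0) = −z + √κ · J_{z+1}(√κ)/J_z(√κ); (d) if moreover z > 0, then u is square-integrable on (0,∞). -/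
open MeasureTheory

noncomputable section

/-- Bessel function of the first kind `J_ν(w)`, with principal complex powers. -/
def besselJ (ν w : ℂ) : ℂ :=
  ∑' n : ℕ, ((-1 : ℂ) ^ n / ((n.factorial : ℂ) * Complex.Gamma (ν + (n : ℂ) + 1))) *
    (w / 2) ^ (ν + 2 * (n : ℂ))

end

noncomputable section BesselAux

/-- Coefficients of the entire part of the Bessel function. -/
def besselCoef (ν : ℂ) (n : ℕ) : ℂ :=
  (-1 : ℂ) ^ n / ((n.factorial : ℂ) * Complex.Gamma (ν + (n : ℂ) + 1))

/-- The entire part of the Bessel function. -/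
def besselF (ν x : ℂ) : ℂ := ∑' n : ℕ, besselCoef ν n * x ^ n

theorem besselGamma_ne (ν : ℂ) (hν : 0 ≤ ν.re) (n : ℕ) : Complex.Gamma (ν + (n : ℂ) + 1) ≠ 0 := by
  apply Complex.Gamma_ne_zero_of_re_pos
  simp
  positivity

theorem besselNe (ν : ℂ) (hν : 0 ≤ ν.re) (n : ℕ) : ν + (n : ℂ) + 1 ≠ 0 := by
  intro h
  have := congrArg Complex.re h
  simp at this
  have h2 : (0 : ℝ) ≤ n := by positivity
  linarith

theorem besselGamma_lower (ν : ℂ) (hν : 0 ≤ ν.re) (n : ℕ) :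
    ‖Complex.Gamma (ν + 1)‖ ≤ ‖Complex.Gamma (ν + (n : ℂ) + 1)‖ := by
  induction n with
  | zero => simp
  | succ k ih =>
    have e : ν + ((k + 1 : ℕ) : ℂ) + 1 = (ν + (k : ℂ) + 1) + 1 := by push_cast; ring
    rw [e, Complex.Gamma_add_one _ (besselNe ν hν k), norm_mul]
    have h1 : 1 ≤ ‖ν + (k : ℂ) + 1‖ := by
      refine le_trans ?_ (Complex.re_le_norm _)
      simp
      positivity
    nlinarith [norm_nonneg (Complex.Gamma (ν + (k : ℂ) + 1))]

theorem besselCoef_bound (ν : ℂ) (hν : 0 ≤ ν.re) (n : ℕ) :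
    ‖besselCoef ν n‖ ≤ ‖Complex.Gamma (ν + 1)‖⁻¹ * (n.factorial : ℝ)⁻¹ := by
  have h0 : 0 < ‖Complex.Gamma (ν + 1)‖ := by
    have := besselGamma_ne ν hν 0
    simp at this
    simpa using this
  unfold besselCoef
  rw [norm_div, norm_mul, norm_pow, norm_neg, norm_one, one_pow, Complex.norm_natCast, one_div,
    mul_inv, mul_comm]
  gcongr
  exact besselGamma_lower ν hν n

theorem besselF_summable (ν : ℂ) (hν : 0 ≤ ν.re) (x : ℂ) :
    Summable fun n : ℕ => besselCoef ν n * x ^ n := by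
  refine Summable.of_norm_bounded
    ((Real.summable_pow_div_factorial ‖x‖).mul_left ‖Complex.Gamma (ν + 1)‖⁻¹) fun n => ?_
  rw [norm_mul, norm_pow]
  have := mul_le_mul_of_nonneg_right (besselCoef_bound ν hν n) (pow_nonneg (norm_nonneg x) n)
  calc _ ≤ _ := this
    _ = _ := by ring

theorem besselCoef_succ (ν : ℂ) (n : ℕ) :
    besselCoef ν (n + 1) * ((n + 1 : ℕ) : ℂ) = - besselCoef (ν + 1) n := by
  unfold besselCoef
  have h1 : ((n + 1 : ℕ) : ℂ) ≠ 0 := by exact_mod_cast Nat.succ_ne_zero n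
  have e : ν + ((n + 1 : ℕ) : ℂ) + 1 = ν + 1 + n + 1 := by push_cast; ring
  rw [e, Nat.factorial_succ, Nat.cast_mul, pow_succ]
  rw [show ((n + 1 : ℕ) : ℂ) * (n.factorial : ℂ) * Complex.Gamma (ν + 1 + n + 1)
    = ((n.factorial : ℂ) * Complex.Gamma (ν + 1 + n + 1)) * ((n + 1 : ℕ) : ℂ) by ring,
    ← div_div, div_mul_cancel₀ _ h1]
  ring

theorem besselF_hasDerivAt (ν : ℂ) (hν : 0 ≤ ν.re) (x : ℂ) :
    HasDerivAt (besselF ν) (- besselF (ν + 1) x) x := by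
  set R : ℝ := ‖x‖ + 1 with hR
  have hR0 : 0 ≤ R := by positivity
  set C := ‖Complex.Gamma (ν + 1)‖⁻¹
  have hC : 0 ≤ C := by positivity
  have hsum : Summable fun n : ℕ => C * (n.factorial : ℝ)⁻¹ * (n * R ^ (n - 1)) := by
    rw [← summable_nat_add_iff 1]
    refine ((Real.summable_pow_div_factorial R).mul_left C).congr fun n => ?_
    have h1 : ((n : ℝ) + 1) ≠ 0 := by positivity
    have h2 : (n.factorial : ℝ) ≠ 0 := by positivity
    rw [Nat.factorial_succ]
    push_cast
    field_simp
  have hd := hasDerivAt_tsum_of_isPreconnected (𝕜 := ℂ) (F := ℂ)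
    (g := fun n y => besselCoef ν n * y ^ n)
    (g' := fun n y => besselCoef ν n * (n * y ^ (n - 1))) (t := Metric.ball 0 R) (y₀ := x) (y := x)
    hsum Metric.isOpen_ball (convex_ball (0 : ℂ) R).isPreconnected
    (fun n y _ => (hasDerivAt_pow n y).const_mul _)
    (fun n y hy => by
      rw [norm_mul, norm_mul, norm_pow, Complex.norm_natCast]
      have hy' : ‖y‖ ≤ R := by simpa using (Metric.mem_ball.1 hy).le
      gcongr
      exact besselCoef_bound ν hν n)
    (by simp [hR]) (besselF_summable ν hν x) (by simp [hR])
  have hs : Summable fun n : ℕ => besselCoef ν n * ((n : ℂ) * x ^ (n - 1)) := by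
    refine Summable.of_norm_bounded hsum fun n => ?_
    rw [norm_mul, norm_mul, norm_pow, Complex.norm_natCast]
    have hy' : ‖x‖ ≤ R := by simp [hR]
    gcongr
    exact besselCoef_bound ν hν n
  have hv : (∑' n : ℕ, besselCoef ν n * ((n : ℂ) * x ^ (n - 1))) = - besselF (ν + 1) x := by
    rw [hs.tsum_eq_zero_add]
    simp only [Nat.add_sub_cancel, ← mul_assoc, besselCoef_succ]
    simp [besselF, tsum_neg]
  rw [← hv]
  exact hd

theorem besselF_rec (ν : ℂ) (hν : 0 ≤ ν.re) (x : ℂ) :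
    besselF ν x = (ν + 1) * besselF (ν + 1) x - x * besselF (ν + 2) x := by
  have hν1 : 0 ≤ (ν + 1).re := by simp; linarith
  have hν2 : 0 ≤ (ν + 2).re := by simp; linarith
  have s0 := besselF_summable ν hν x
  have s1 := besselF_summable (ν + 1) hν1 x
  have s2 := besselF_summable (ν + 2) hν2 x
  have key : ∀ n : ℕ, besselCoef ν n = (ν + 1 + n) * besselCoef (ν + 1) n := by
    intro n
    unfold besselCoef
    have e : ν + 1 + (n : ℂ) + 1 = (ν + n + 1) + 1 := by ring
    have hg := besselGamma_ne ν hν n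
    have hn := besselNe ν hν n
    have hf : (n.factorial : ℂ) ≠ 0 := by exact_mod_cast n.factorial_ne_zero
    rw [e, Complex.Gamma_add_one _ hn, show ν + 1 + (n : ℂ) = ν + n + 1 by ring]
    field_simp
  have e1 : HasSum (fun n : ℕ => (n : ℂ) * besselCoef (ν + 1) n * x ^ n)
      (- (x * besselF (ν + 2) x)) := by
    rw [← hasSum_nat_add_iff' 1]
    simp only [Finset.range_one, Finset.sum_singleton, Nat.cast_zero, zero_mul, sub_zero]
    have h := (s2.hasSum.mul_left x).neg
    refine h.congr_fun ?_
    intro n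
    have := besselCoef_succ (ν + 1) n
    rw [show ν + 1 + 1 = ν + 2 by ring] at this
    rw [mul_comm ((n + 1 : ℕ) : ℂ), this, pow_succ]
    ring
  have h2 := (s1.hasSum.mul_left (ν + 1)).add e1
  have h3 : HasSum (fun n : ℕ => besselCoef ν n * x ^ n)
      ((ν + 1) * besselF (ν + 1) x + - (x * besselF (ν + 2) x)) := by
    refine h2.congr_fun ?_
    intro n
    rw [key]
    ring
  rw [besselF, h3.tsum_eq]
  ring

theorem besselJ_eq (ν w : ℂ) (hw : w ≠ 0) :
    besselJ ν w = (w / 2) ^ ν * besselF ν ((w / 2) ^ 2) := by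
  unfold besselJ besselF
  rw [← tsum_mul_left]
  congr 1
  ext n
  have hw2 : w / 2 ≠ 0 := by simpa using hw
  rw [Complex.cpow_add _ _ hw2, show (2 * (n : ℂ)) = ((2 * n : ℕ) : ℂ) by push_cast; ring,
    Complex.cpow_natCast, pow_mul]
  unfold besselCoef
  ring

theorem bessel_cpow (s ν : ℂ) (hs : s ≠ 0) (t : ℝ) :
    (s * Complex.exp (-(t : ℂ)) / 2) ^ ν = (s / 2) ^ ν * Complex.exp (-(ν * t)) := by
  have h2 : s / 2 ≠ 0 := by simpa using hs
  have e : s * Complex.exp (-(t : ℂ)) / 2 = ((Real.exp (-t) : ℝ) : ℂ) * (s / 2) := by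
    push_cast; ring
  have h3 : ((Real.exp (-t) : ℝ) : ℂ) * (s / 2) ≠ 0 :=
    mul_ne_zero (by exact_mod_cast (Real.exp_pos _).ne') h2
  rw [e, Complex.cpow_def_of_ne_zero h3, Complex.cpow_def_of_ne_zero h2,
    Complex.log_ofReal_mul (Real.exp_pos _) h2, Real.log_exp, ← Complex.exp_add]
  congr 1
  push_cast
  ring

end BesselAux

/-- the function `u(t) = J_z(√κ e^{−t})/J_z(√κ)` is smooth on `[0,∞)`, satisfies
`u(0)=1`, solves `u'' = (z² − κe^{−2t})u`, has `u'(0) = −z + √κ J_{z+1}(√κ)/J_z(√κ)`, and is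
square-integrable on `(0,∞)` when `z > 0`. -/
theorem bessel_ode_solution (κ : ℂ) (hκ : κ ≠ 0) (z : ℝ) (hz : 0 ≤ z)
    (hJ : besselJ (z : ℂ) (κ ^ (1/2 : ℂ)) ≠ 0)
    (u : ℝ → ℂ)
    (hu : u = fun t : ℝ =>
      besselJ (z : ℂ) (κ ^ (1/2 : ℂ) * Complex.exp (-(t : ℂ))) /
        besselJ (z : ℂ) (κ ^ (1/2 : ℂ))) :
    ContDiffOn ℝ (⊤ : ℕ∞) u (Set.Ici 0) ∧ u 0 = 1 ∧
    (∀ t : ℝ, 0 ≤ t →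
      deriv (deriv u) t = ((z : ℂ) ^ 2 - κ * Complex.exp (-2 * (t : ℂ))) * u t) ∧
    deriv u 0 = -(z : ℂ) + κ ^ (1/2 : ℂ) *
      besselJ ((z : ℂ) + 1) (κ ^ (1/2 : ℂ)) / besselJ (z : ℂ) (κ ^ (1/2 : ℂ)) ∧
    (0 < z → Integrable (fun t => ‖u t‖ ^ 2) (volume.restrict (Set.Ioi (0 : ℝ)))) := by
  set s : ℂ := κ ^ (1/2 : ℂ) with hs
  have hs2 : s ^ 2 = κ := by
    rw [hs, ← Complex.cpow_nat_mul]
    simp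
  have hs0 : s ≠ 0 := by
    intro h
    apply hκ
    rw [← hs2, h]
    simp
  set ν : ℂ := (z : ℂ) with hν
  have hν0 : 0 ≤ ν.re := by simpa [hν] using hz
  have hν1 : 0 ≤ (ν + 1).re := by simp [hν]; linarith
  set q : ℂ := κ / 4 with hq
  set c : ℂ := (s / 2) ^ ν / besselJ ν s with hc
  have hsq : (s / 2) ^ 2 = q := by rw [div_pow, hs2, hq]; norm_num
  have huf : u = fun t : ℝ => c * Complex.exp (-(ν * t)) * besselF ν (q * Complex.exp (-2 * (t : ℂ))) := by
    rw [hu]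
    funext t
    rw [besselJ_eq ν _ (mul_ne_zero hs0 (Complex.exp_ne_zero _)), bessel_cpow s ν hs0]
    have e : (s * Complex.exp (-(t : ℂ)) / 2) ^ 2 = q * Complex.exp (-2 * (t : ℂ)) := by
      rw [← hsq, show (-2 * (t : ℂ)) = -(t : ℂ) + -(t : ℂ) by ring, Complex.exp_add]
      ring
    rw [e, hc]
    ring
  have hdt : ∀ t : ℝ, HasDerivAt (fun t : ℝ => (t : ℂ)) 1 t := fun t => Complex.ofRealCLM.hasDerivAt
  have hE : ∀ t : ℝ, HasDerivAt (fun t : ℝ => c * Complex.exp (-(ν * t)))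
      (c * (Complex.exp (-(ν * t)) * (-(ν * 1)))) t := fun t =>
    (((hdt t).const_mul ν).neg.cexp).const_mul c
  have hX : ∀ t : ℝ, HasDerivAt (fun t : ℝ => q * Complex.exp (-2 * (t : ℂ)))
      (q * (Complex.exp (-2 * (t : ℂ)) * (-2 * 1))) t := fun t =>
    (((hdt t).const_mul (-2)).cexp).const_mul q
  have hF0 : ∀ t : ℝ, HasDerivAt (fun t : ℝ => besselF ν (q * Complex.exp (-2 * (t : ℂ))))
      (-besselF (ν + 1) (q * Complex.exp (-2 * (t : ℂ))) *
        (q * (Complex.exp (-2 * (t : ℂ)) * (-2 * 1)))) t := fun t =>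
    HasDerivAt.comp t (besselF_hasDerivAt ν hν0 _) (hX t)
  have hF1 : ∀ t : ℝ, HasDerivAt (fun t : ℝ => besselF (ν + 1) (q * Complex.exp (-2 * (t : ℂ))))
      (-besselF (ν + 1 + 1) (q * Complex.exp (-2 * (t : ℂ))) *
        (q * (Complex.exp (-2 * (t : ℂ)) * (-2 * 1)))) t := fun t =>
    HasDerivAt.comp t (besselF_hasDerivAt (ν + 1) hν1 _) (hX t)
  have hd1 : deriv u = fun t : ℝ => c * Complex.exp (-(ν * t)) *
      (-ν * besselF ν (q * Complex.exp (-2 * (t : ℂ))) + 2 * (q * Complex.exp (-2 * (t : ℂ))) *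
        besselF (ν + 1) (q * Complex.exp (-2 * (t : ℂ)))) := by
    funext t
    have h := (hE t).mul (hF0 t)
    rw [huf]
    refine h.deriv.trans ?_
    ring
  have hd2 : ∀ t : ℝ, deriv (deriv u) t = (ν ^ 2 - κ * Complex.exp (-2 * (t : ℂ))) * u t := by
    intro t
    have h := (hE t).mul (((hF0 t).const_mul (-ν)).add (((hX t).const_mul 2).mul (hF1 t)))
    rw [hd1]
    refine h.deriv.trans ?_
    rw [huf, show κ = 4 * q by rw [hq]; ring]
    have hrec := besselF_rec ν hν0 (q * Complex.exp (-2 * (t : ℂ)))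
    rw [show ν + 1 + 1 = ν + 2 by ring]
    simp only [Pi.add_apply, Pi.mul_apply]
    linear_combination (-4 * c * Complex.exp (-(ν * t)) * (q * Complex.exp (-2 * (t : ℂ)))) * -hrec
  have hFd : Differentiable ℂ (besselF ν) := fun x => (besselF_hasDerivAt ν hν0 x).differentiableAt
  have hcd : ContDiff ℝ (⊤ : ℕ∞) u := by
    have h1 : ContDiff ℝ (⊤ : ℕ∞) (besselF ν) := (hFd.contDiff).restrict_scalars ℝ
    have h2 : ContDiff ℝ (⊤ : ℕ∞) (fun t : ℝ => (t : ℂ)) := Complex.ofRealCLM.contDiff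
    rw [huf]
    exact (contDiff_const.mul (contDiff_const.mul h2).neg.cexp).mul
      (h1.comp (contDiff_const.mul (contDiff_const.mul h2).cexp))
  refine ⟨hcd.contDiffOn, ?_, fun t _ => hd2 t, ?_, ?_⟩
  · rw [hu]
    simp [hJ]
  · have hp : (s / 2) ^ (ν + 1) = (s / 2) ^ ν * (s / 2) := by
      rw [Complex.cpow_add _ _ (by simpa using hs0), Complex.cpow_one]
    have hJ0 := besselJ_eq ν s hs0
    have hJ1 := besselJ_eq (ν + 1) s hs0
    rw [hp] at hJ1
    rw [hd1, hJ1, hsq]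
    rw [hsq] at hJ0
    simp only [Complex.ofReal_zero, mul_zero, neg_zero, Complex.exp_zero, mul_one, hc]
    field_simp
    rw [← hsq, ← hsq] at *
    linear_combination 2 * ν * hJ0
  · intro hz0
    obtain ⟨M, hM⟩ := (isCompact_closedBall (0 : ℂ) ‖q‖).exists_bound_of_continuousOn
      hFd.continuous.continuousOn
    have hint := (exp_neg_integrableOn_Ioi 0 (show 0 < 2 * z by linarith)).const_mul ((‖c‖ * M) ^ 2)
    refine Integrable.mono' hint (hcd.continuous.norm.pow 2).aestronglyMeasurable ?_
    refine (ae_restrict_iff' measurableSet_Ioi).2 (Filter.Eventually.of_forall fun t ht => ?_)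
    have ht0 : 0 < t := ht
    have hx : ‖besselF ν (q * Complex.exp (-2 * (t : ℂ)))‖ ≤ M := by
      apply hM
      rw [mem_closedBall_zero_iff, norm_mul, Complex.norm_exp]
      have : Real.exp ((-2 * (t : ℂ)).re) ≤ 1 := by
        apply Real.exp_le_one_iff.2
        simp
        linarith
      exact mul_le_of_le_one_right (norm_nonneg _) this
    have hn : ‖u t‖ ≤ ‖c‖ * M * Real.exp (-(z * t)) := by
      rw [huf]
      simp only [norm_mul]
      have : ‖Complex.exp (-(ν * t))‖ = Real.exp (-(z * t)) := by
        rw [Complex.norm_exp]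
        simp [hν]
      rw [this]
      calc _ ≤ ‖c‖ * Real.exp (-(z * t)) * M := by gcongr
        _ = _ := by ring
    rw [Real.norm_of_nonneg (by positivity)]
    calc ‖u t‖ ^ 2 ≤ (‖c‖ * M * Real.exp (-(z * t))) ^ 2 := by gcongr
      _ = _ := by
        rw [mul_pow, ← Real.exp_nat_mul]
        congr 2
        push_cast
        ring
end

section
/- Let A ≥ 0 and let G be a measurable complex-valued function on D := {(x,t) : 0 < t ≤ x} with |G(x,t)| ≤ A e^{−x} for all (x,t) ∈ D. Define the iterated kernels G¹ := G and G^{n+1}(x,t) := ∫_t^x G(x,s) G^n(s,t) ds. Then: (a) |G^n(x,t)| ≤ (A^n/(n−1)!) e^{−x} for all n ≥ 1 and (x,t) ∈ D; (b) there exists a measurable kernel G̃ on D with |G̃(x,t)| ≤ A e^{A} e^{−x} on D such that for every F ∈ L¹_loc([0,∞)) one has (I + T_{G̃})((I + T_G)F) = F and (I + T_G)((I + T_{G̃})F) = F almost everywhere on (0,∞); consequently, if Φ = (I + T_G)F then |F(x) − Φ(x)| ≤ A e^{A} e^{−x} ∫₀^x |Φ(t)| dt for a.e. x > 0. -/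
open MeasureTheory

noncomputable section

/-- The Volterra operator `T_H F(x) = ∫₀^x H(x,t) F(t) dt`. -/
def volterraOp (H : ℝ → ℝ → ℂ) (F : ℝ → ℂ) (x : ℝ) : ℂ :=
  ∫ t in Set.Ioc (0 : ℝ) x, H x t * F t

/-- The operator `(I + T_H) F`. -/
def applyOp (H : ℝ → ℝ → ℂ) (F : ℝ → ℂ) (x : ℝ) : ℂ :=
  F x + volterraOp H F x

/-- Iterated kernels: `iterKernel G n` is `G^{n+1}`, i.e. `iterKernel G 0 = G¹ = G` and
`G^{n+1}(x,t) = ∫_t^x G(x,s) G^n(s,t) ds`. -/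
def iterKernel (G : ℝ → ℝ → ℂ) : ℕ → ℝ → ℝ → ℂ
  | 0 => G
  | n + 1 => fun x t => ∫ s in t..x, G x s * iterKernel G n s t

end

/-- A bounded measurable kernel supported on `D`. -/
structure VK (C : ℝ) (H : ℝ → ℝ → ℂ) : Prop where
  meas : Measurable (Function.uncurry H)
  bound : ∀ x t, ‖H x t‖ ≤ C
  supp : ∀ x t, ¬ (0 < t ∧ t ≤ x) → H x t = 0

def LocInt (F : ℝ → ℂ) : Prop := ∀ x : ℝ, IntegrableOn F (Set.Ioc 0 x)

theorem VK.nonneg {C : ℝ} {H : ℝ → ℝ → ℂ} (h : VK C H) : 0 ≤ C :=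
  (norm_nonneg _).trans (h.bound 0 0)

theorem VK.volterraOp_eq {C : ℝ} {H : ℝ → ℝ → ℂ} (h : VK C H) (F : ℝ → ℂ) (x : ℝ) :
    volterraOp H F x = ∫ t, H x t * F t := by
  unfold volterraOp
  apply setIntegral_eq_integral_of_forall_compl_eq_zero
  intro t ht
  rw [h.supp x t ht, zero_mul]

theorem VK.meas_left {C : ℝ} {H : ℝ → ℝ → ℂ} (h : VK C H) (x : ℝ) : Measurable (H x) :=
  h.meas.comp (measurable_const.prodMk measurable_id)

theorem VK.meas_right {C : ℝ} {H : ℝ → ℝ → ℂ} (h : VK C H) (t : ℝ) :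
    Measurable (fun s => H s t) :=
  h.meas.comp (measurable_id.prodMk measurable_const)

theorem VK.locInt {C : ℝ} {H : ℝ → ℝ → ℂ} (h : VK C H) (t : ℝ) :
    LocInt (fun s => H s t) := by
  intro x
  refine Integrable.mono' (g := fun _ => C) ?_ (h.meas_right t).aestronglyMeasurable
    (Filter.Eventually.of_forall fun s => h.bound s t)
  exact integrableOn_const (by simp) (by simp)

theorem VK.integrable {C : ℝ} {H : ℝ → ℝ → ℂ} (h : VK C H) {F : ℝ → ℂ} (hF : LocInt F) (x : ℝ) :
    Integrable (fun t => H x t * F t) := by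
  have h1 : IntegrableOn (fun t => H x t * F t) (Set.Ioc 0 x) :=
    (hF x).bdd_mul (h.meas_left x).aestronglyMeasurable
      (Filter.Eventually.of_forall fun t => h.bound x t)
  refine (integrableOn_iff_integrable_of_support_subset ?_).1 h1
  intro t ht
  by_contra hc
  exact ht (by simp [h.supp x t hc])

theorem VK.fubini {C₁ C₂ : ℝ} {H₁ H₂ : ℝ → ℝ → ℂ} (h₁ : VK C₁ H₁) (h₂ : VK C₂ H₂)
    {F : ℝ → ℂ} (hF : LocInt F) (x : ℝ) :
    Integrable (Function.uncurry fun s t => H₁ x s * (H₂ s t * F t)) := by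
  have e : (Function.uncurry fun s t => H₁ x s * (H₂ s t * F t)) =
      fun p : ℝ × ℝ => H₂ p.1 p.2 *
        (H₁ x p.1 * (Set.Ioc (0:ℝ) x).indicator F p.2) := by
    funext ⟨s, t⟩
    simp only [Function.uncurry]
    by_cases ht : t ∈ Set.Ioc 0 x
    · rw [Set.indicator_of_mem ht]; ring
    · rw [Set.indicator_of_notMem ht]
      by_cases h1 : 0 < s ∧ s ≤ x
      · rw [h₂.supp s t (fun h => ht ⟨h.1, h.2.trans h1.2⟩)]; simp
      · rw [h₁.supp x s h1]; simp
  rw [e]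
  have hH : Integrable (H₁ x) := by
    have := h₁.integrable (F := fun _ => 1) (fun y => integrableOn_const (by simp) (by simp)) x
    simpa using this
  have hI : Integrable ((Set.Ioc (0:ℝ) x).indicator F) :=
    (integrable_indicator_iff measurableSet_Ioc).2 (hF x)
  have := hH.mul_prod hI
  exact this.bdd_mul (c := C₂) h₂.meas.aestronglyMeasurable
      (Filter.Eventually.of_forall fun p => h₂.bound p.1 p.2)

/-- Composition. -/
theorem VK.op_op {C₁ C₂ : ℝ} {H₁ H₂ : ℝ → ℝ → ℂ} (h₁ : VK C₁ H₁) (h₂ : VK C₂ H₂)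
    {F : ℝ → ℂ} (hF : LocInt F) (x : ℝ) :
    ∫ s, H₁ x s * ∫ t, H₂ s t * F t = ∫ t, (∫ s, H₁ x s * H₂ s t) * F t := by
  have := integral_integral_swap (h₁.fubini h₂ hF x)
  simp only [integral_const_mul] at this
  rw [this]
  congr 1; funext t
  rw [← integral_mul_const]
  congr 1; funext s; ring

theorem VK_one : VK 1 (fun x t => if 0 < t ∧ t ≤ x then 1 else 0) where
  meas := by
    refine Measurable.ite ?_ measurable_const measurable_const
    exact (measurableSet_lt measurable_const measurable_snd).inter
      (measurableSet_le measurable_snd measurable_fst)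
  bound x t := by split_ifs <;> simp
  supp x t h := by simp [h]

theorem VK.locInt_op {C : ℝ} {H : ℝ → ℝ → ℂ} (h : VK C H) {F : ℝ → ℂ} (hF : LocInt F) :
    LocInt (fun s => ∫ t, H s t * F t) := by
  intro x
  have := (VK_one.fubini h hF x).integral_prod_left
  simp only [Function.uncurry] at this
  refine (this.integrableOn (s := Set.Ioc 0 x)).congr_fun ?_ measurableSet_Ioc
  intro s hs
  have hs' : 0 < s ∧ s ≤ x := hs
  simp only [hs', and_self, if_true, one_mul]

/-- If `R + K + R∘K = 0` then `(I+R)(I+K) = I`. -/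
theorem VK.inverse {C₁ C₂ : ℝ} {R K : ℝ → ℝ → ℂ} (h₁ : VK C₁ R) (h₂ : VK C₂ K)
    (hRK : ∀ x t, ∫ s, R x s * K s t = - K x t - R x t)
    {F : ℝ → ℂ} (hF : LocInt F) (x : ℝ) :
    applyOp R (applyOp K F) x = F x := by
  have e : applyOp K F = fun s => F s + ∫ t, K s t * F t := by
    funext s; rw [applyOp, h₂.volterraOp_eq]
  rw [applyOp, h₁.volterraOp_eq, e]
  simp only [mul_add]
  rw [integral_add (h₁.integrable hF x) (h₁.integrable (h₂.locInt_op hF) x),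
    h₁.op_op h₂ hF x]
  simp only [hRK, sub_mul, neg_mul]
  have h3 : ∫ t, (-(K x t * F t) - R x t * F t) =
      (∫ t, -(K x t * F t)) - ∫ t, R x t * F t :=
    integral_sub (h₂.integrable hF x).neg (h₁.integrable hF x)
  rw [h3, integral_neg]
  ring

theorem iter_bound (A : ℝ) (hA : 0 ≤ A) (G : ℝ → ℝ → ℂ)
    (hGbound : ∀ x t : ℝ, 0 < t → t ≤ x → ‖G x t‖ ≤ A * Real.exp (-x)) (n : ℕ) :
    ∀ x t : ℝ, 0 < t → t ≤ x → ‖iterKernel G n x t‖ ≤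
      A ^ (n + 1) / (n.factorial : ℝ) * Real.exp (-x) *
        (Real.exp (-t) - Real.exp (-x)) ^ n := by
  induction n with
  | zero => intro x t h0 h1; simpa [iterKernel] using hGbound x t h0 h1
  | succ n ih =>
    intro x t h0 h1
    set g : ℝ → ℝ := fun s => A * Real.exp (-x) * (A ^ (n + 1) / (n.factorial : ℝ)) *
      (Real.exp (-s) * (Real.exp (-t) - Real.exp (-s)) ^ n) with hg
    have hgc : Continuous g := by rw [hg]; fun_prop
    have h2 : ‖∫ s in t..x, G x s * iterKernel G n s t‖ ≤ ∫ s in t..x, g s := by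
      refine intervalIntegral.norm_integral_le_of_norm_le h1 ?_ (hgc.intervalIntegrable _ _)
      refine Filter.Eventually.of_forall fun s hs => ?_
      rw [norm_mul]
      have a1 := hGbound x s (h0.trans hs.1) hs.2
      have a2 := ih s t h0 hs.1.le
      calc _ ≤ _ := mul_le_mul a1 a2 (norm_nonneg _) (by positivity)
        _ = g s := by rw [hg]; ring
    have h3 : ∫ s in t..x, Real.exp (-s) * (Real.exp (-t) - Real.exp (-s)) ^ n =
        (Real.exp (-t) - Real.exp (-x)) ^ (n+1) / (n+1 : ℝ) := by
      have hd : ∀ s ∈ Set.uIcc t x, HasDerivAt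
          (fun s : ℝ => (Real.exp (-t) - Real.exp (-s)) ^ (n+1) / (n+1 : ℝ))
          (Real.exp (-s) * (Real.exp (-t) - Real.exp (-s)) ^ n) s := by
        intro s _
        have b1 : HasDerivAt (fun s : ℝ => Real.exp (-s)) (Real.exp (-s) * (-1)) s :=
          (hasDerivAt_neg s).exp
        have b2 := ((b1.const_sub (Real.exp (-t))).pow (n+1)).div_const (n+1 : ℝ)
        refine b2.congr_deriv ?_
        have : (n+1 : ℝ) ≠ 0 := by positivity
        push_cast
        field_simp
      rw [intervalIntegral.integral_eq_sub_of_hasDerivAt hd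
        (Continuous.intervalIntegrable (by fun_prop) _ _)]
      simp
    rw [hg, intervalIntegral.integral_const_mul, h3] at h2
    refine h2.trans (le_of_eq ?_)
    rw [Nat.factorial_succ]
    have : (n+1 : ℝ) ≠ 0 := by positivity
    have : (n.factorial : ℝ) ≠ 0 := by positivity
    push_cast
    field_simp
    ring

theorem iter_bound' (A : ℝ) (hA : 0 ≤ A) (G : ℝ → ℝ → ℂ)
    (hGbound : ∀ x t : ℝ, 0 < t → t ≤ x → ‖G x t‖ ≤ A * Real.exp (-x)) (n : ℕ)
    (x t : ℝ) (h0 : 0 < t) (h1 : t ≤ x) : ‖iterKernel G n x t‖ ≤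
      A ^ (n + 1) / (n.factorial : ℝ) * Real.exp (-x) := by
  refine (iter_bound A hA G hGbound n x t h0 h1).trans ?_
  apply mul_le_of_le_one_right (by positivity)
  have h2 : Real.exp (-x) ≤ Real.exp (-t) := Real.exp_le_exp.2 (by linarith)
  have h3 : Real.exp (-t) ≤ 1 := Real.exp_le_one_iff.2 (by linarith)
  have h4 := Real.exp_pos (-x)
  exact pow_le_one₀ (by linarith) (by linarith)

open Classical in
/-- truncated iterated kernels -/
noncomputable def Kn (G : ℝ → ℝ → ℂ) (n : ℕ) (x t : ℝ) : ℂ :=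
  if 0 < t ∧ t ≤ x then iterKernel G n x t else 0

theorem Kn_succ (G : ℝ → ℝ → ℂ) (n : ℕ) (x t : ℝ) :
    Kn G (n+1) x t = ∫ s, Kn G 0 x s * Kn G n s t := by
  by_cases h : 0 < t ∧ t ≤ x
  · rw [Kn, if_pos h]
    simp only [iterKernel]
    rw [intervalIntegral.integral_of_le h.2, ← integral_Icc_eq_integral_Ioc,
      ← integral_indicator measurableSet_Icc]
    congr 1; funext s
    by_cases hs : s ∈ Set.Icc t x
    · rw [Set.indicator_of_mem hs, Kn, Kn, if_pos ⟨h.1.trans_le hs.1, hs.2⟩, if_pos ⟨h.1, hs.1⟩]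
      rfl
    · rw [Set.indicator_of_notMem hs, Kn, Kn]
      split_ifs with h1 h2
      · exact absurd ⟨h2.2, h1.2⟩ hs
      all_goals simp
  · rw [Kn, if_neg h]
    symm
    rw [← integral_zero ℝ ℂ (μ := volume)]
    congr 1; funext s
    rw [Kn, Kn]
    split_ifs with h1 h2
    · exact absurd ⟨h2.1, h2.2.trans h1.2⟩ h
    all_goals simp

section main
variable {A : ℝ} (hA : 0 ≤ A) {G : ℝ → ℝ → ℂ} (hGmeas : Measurable (Function.uncurry G))
    (hGbound : ∀ x t : ℝ, 0 < t → t ≤ x → ‖G x t‖ ≤ A * Real.exp (-x))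

theorem Kn_meas (G : ℝ → ℝ → ℂ) (hGmeas : Measurable (Function.uncurry G)) (n : ℕ) :
    Measurable (Function.uncurry (Kn G n)) := by
  have h0 : Measurable (Function.uncurry (Kn G 0)) := by
    refine Measurable.ite ?_ hGmeas measurable_const
    exact (measurableSet_lt measurable_const measurable_snd).inter
      (measurableSet_le measurable_snd measurable_fst)
  induction n with
  | zero => exact h0
  | succ n ih =>
    have e : Function.uncurry (Kn G (n+1)) =
        fun p : ℝ × ℝ => ∫ s, Kn G 0 p.1 s * Kn G n s p.2 := by
      funext ⟨x, t⟩; exact Kn_succ G n x t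
    rw [e]
    have : StronglyMeasurable (fun q : (ℝ × ℝ) × ℝ => Kn G 0 q.1.1 q.2 * Kn G n q.2 q.1.2) := by
      apply Measurable.stronglyMeasurable
      apply Measurable.mul
      · exact h0.comp ((measurable_fst.comp measurable_fst).prodMk measurable_snd)
      · exact ih.comp (measurable_snd.prodMk (measurable_snd.comp measurable_fst))
    exact this.integral_prod_right.measurable

include hA hGbound

theorem Kn_bound (n : ℕ) (x t : ℝ) :
    ‖Kn G n x t‖ ≤ A ^ (n + 1) / (n.factorial : ℝ) * Real.exp (-x) := by
  rw [Kn]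
  split_ifs with h
  · exact iter_bound' A hA G hGbound n x t h.1 h.2
  · rw [norm_zero]; positivity

theorem Kn_bound1 (n : ℕ) (x t : ℝ) :
    ‖Kn G n x t‖ ≤ A ^ (n + 1) / (n.factorial : ℝ) := by
  by_cases h : 0 < t ∧ t ≤ x
  · refine (Kn_bound hA hGbound n x t).trans (mul_le_of_le_one_right (by positivity) ?_)
    exact Real.exp_le_one_iff.2 (by linarith)
  · rw [Kn, if_neg h, norm_zero]; positivity

omit hA hGbound in
theorem hasSum_bd (A : ℝ) : HasSum (fun n : ℕ => A ^ (n + 1) / (n.factorial : ℝ))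
    (A * Real.exp A) := by
  have := (NormedSpace.expSeries_div_hasSum_exp (𝔸 := ℝ) A).mul_left A
  rw [← Real.exp_eq_exp_ℝ] at this
  have e : (fun n : ℕ => A ^ (n + 1) / (n.factorial : ℝ)) =
      fun n : ℕ => A * (A ^ n / (n.factorial : ℝ)) := by
    funext n; ring
  rw [e]; exact this

include hGmeas

theorem Kn_VK (n : ℕ) : VK (A ^ (n + 1) / (n.factorial : ℝ)) (Kn G n) where
  meas := Kn_meas G hGmeas n
  bound := Kn_bound1 hA hGbound n
  supp x t h := by rw [Kn, if_neg h]

theorem Kn_succ' (n : ℕ) (x t : ℝ) :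
    Kn G (n+1) x t = ∫ s, Kn G n x s * Kn G 0 s t := by
  induction n generalizing x t with
  | zero => exact Kn_succ G 0 x t
  | succ n ih =>
    rw [Kn_succ]
    simp only [ih]
    rw [(Kn_VK hA hGmeas hGbound 0).op_op (Kn_VK hA hGmeas hGbound n)
      ((Kn_VK hA hGmeas hGbound 0).locInt t) x]
    simp only [← Kn_succ, ← ih]

omit hA hGbound hGmeas in
/-- the resolvent kernel -/
noncomputable def Rk (G : ℝ → ℝ → ℂ) (x t : ℝ) : ℂ := ∑' n : ℕ, (-1) ^ (n+1) * Kn G n x t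

omit hGmeas in
theorem Rk_hasSum (x t : ℝ) : HasSum (fun n : ℕ => (-1) ^ (n+1) * Kn G n x t) (Rk G x t) := by
  refine (Summable.of_norm_bounded (hasSum_bd A).summable ?_).hasSum
  intro n
  simpa using Kn_bound1 hA hGbound n x t

omit hGmeas in
theorem Rk_bound (x t : ℝ) : ‖Rk G x t‖ ≤ A * Real.exp A * Real.exp (-x) := by
  refine tsum_of_norm_bounded ((hasSum_bd A).mul_right (Real.exp (-x))) ?_
  intro n
  simpa using Kn_bound hA hGbound n x t

omit hGmeas in
theorem Rk_bound1 (x t : ℝ) : ‖Rk G x t‖ ≤ A * Real.exp A := by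
  refine tsum_of_norm_bounded (hasSum_bd A) ?_
  intro n
  simpa using Kn_bound1 hA hGbound n x t

theorem Rk_VK : VK (A * Real.exp A) (Rk G) where
  meas := by
    refine measurable_of_tendsto_metrizable (f := fun N : ℕ => fun p : ℝ × ℝ =>
        ∑ n ∈ Finset.range N, (-1) ^ (n+1) * Kn G n p.1 p.2) ?_ ?_
    · intro N
      refine Finset.measurable_fun_sum _ fun n _ => ?_
      exact (Kn_meas G hGmeas n).const_mul _
    · rw [tendsto_pi_nhds]
      rintro ⟨x, t⟩
      exact (Rk_hasSum hA hGbound x t).tendsto_sum_nat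
  bound := Rk_bound1 hA hGbound
  supp x t h := by simp [Rk, Kn, h]

theorem Rk_tail (x t : ℝ) :
    HasSum (fun n : ℕ => (-1) ^ (n+1) * Kn G (n+1) x t) (- Kn G 0 x t - Rk G x t) := by
  have h := (hasSum_nat_add_iff' 1).2 (Rk_hasSum hA hGbound x t)
  have h' := h.neg
  have e1 : (fun n : ℕ => -((-1) ^ (n+1+1) * Kn G (n+1) x t)) =
      fun n : ℕ => (-1) ^ (n+1) * Kn G (n+1) x t := by
    funext n; ring
  have e2 : -(Rk G x t - ∑ i ∈ Finset.range 1, (-1) ^ (i + 1) * Kn G i x t) =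
      - Kn G 0 x t - Rk G x t := by
    rw [Finset.sum_range_one]; ring
  rw [← e1, ← e2]; exact h'

theorem Rk_right (x t : ℝ) : ∫ s, Kn G 0 x s * Rk G s t = - Rk G x t - Kn G 0 x t := by
  have hI : Integrable (fun s => Kn G 0 x s) := by
    have := (Kn_VK hA hGmeas hGbound 0).integrable (F := fun _ => 1)
      (fun y => integrableOn_const (by simp) (by simp)) x
    simpa using this
  have h := hasSum_integral_of_dominated_convergence (μ := volume)
    (F := fun n s => Kn G 0 x s * ((-1) ^ (n+1) * Kn G n s t))
    (f := fun s => Kn G 0 x s * Rk G s t)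
    (fun n s => ‖Kn G 0 x s‖ * (A ^ (n + 1) / (n.factorial : ℝ)))
    (fun n => (((Kn_VK hA hGmeas hGbound 0).meas_left x).mul
      (((Kn_VK hA hGmeas hGbound n).meas_right t).const_mul _)).aestronglyMeasurable)
    (fun n => Filter.Eventually.of_forall fun s => by
      rw [norm_mul]
      gcongr
      simpa using Kn_bound1 hA hGbound n s t)
    (Filter.Eventually.of_forall fun s => (hasSum_bd A).summable.mul_left _)
    (by
      simp only [tsum_mul_left]
      exact hI.norm.mul_const _)
    (Filter.Eventually.of_forall fun s => (Rk_hasSum hA hGbound s t).mul_left _)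
  have h2 := Rk_tail hA hGmeas hGbound x t
  have e : (fun n : ℕ => ∫ s, Kn G 0 x s * ((-1) ^ (n+1) * Kn G n s t)) =
      fun n : ℕ => (-1) ^ (n+1) * Kn G (n+1) x t := by
    funext n
    rw [Kn_succ, ← integral_const_mul]
    congr 1; funext s; ring
  rw [e] at h
  rw [h.unique h2]; ring

theorem Rk_left (x t : ℝ) : ∫ s, Rk G x s * Kn G 0 s t = - Kn G 0 x t - Rk G x t := by
  have hI : IntegrableOn (fun s => Kn G 0 s t) (Set.Ioc 0 x) :=
    (Kn_VK hA hGmeas hGbound 0).locInt t x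
  have hs : ∀ s, s ∉ Set.Ioc 0 x → ∀ n, Kn G n x s = 0 := fun s hs n =>
    (Kn_VK hA hGmeas hGbound n).supp x s hs
  have h := hasSum_integral_of_dominated_convergence (μ := volume.restrict (Set.Ioc 0 x))
    (F := fun n s => ((-1) ^ (n+1) * Kn G n x s) * Kn G 0 s t)
    (f := fun s => Rk G x s * Kn G 0 s t)
    (fun n s => (A ^ (n + 1) / (n.factorial : ℝ)) * ‖Kn G 0 s t‖)
    (fun n => ((((Kn_VK hA hGmeas hGbound n).meas_left x).const_mul _).mul
      ((Kn_VK hA hGmeas hGbound 0).meas_right t)).aestronglyMeasurable)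
    (fun n => Filter.Eventually.of_forall fun s => by
      rw [norm_mul]
      gcongr
      simpa using Kn_bound1 hA hGbound n x s)
    (Filter.Eventually.of_forall fun s => (hasSum_bd A).summable.mul_right _)
    (by
      simp only [tsum_mul_right]
      exact hI.norm.const_mul _)
    (Filter.Eventually.of_forall fun s => (Rk_hasSum hA hGbound x s).mul_right _)
  have h2 := Rk_tail hA hGmeas hGbound x t
  have e : (fun n : ℕ => ∫ s in Set.Ioc 0 x, ((-1) ^ (n+1) * Kn G n x s) * Kn G 0 s t) =
      fun n : ℕ => (-1) ^ (n+1) * Kn G (n+1) x t := by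
    funext n
    rw [Kn_succ' hA hGmeas hGbound, ← integral_const_mul,
      setIntegral_eq_integral_of_forall_compl_eq_zero]
    · congr 1; funext s; ring
    · intro s h'; rw [hs s h']; simp
  rw [e] at h
  rw [← h.unique h2, setIntegral_eq_integral_of_forall_compl_eq_zero]
  intro s h'
  rw [(Rk_VK hA hGmeas hGbound).supp x s h', zero_mul]

end main

theorem applyOp_Kn (G : ℝ → ℝ → ℂ) (F : ℝ → ℂ) : applyOp G F = applyOp (Kn G 0) F := by
  funext x
  rw [applyOp, applyOp, volterraOp, volterraOp]
  congr 1
  refine setIntegral_congr_fun measurableSet_Ioc fun t ht => ?_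
  have ht' : 0 < t ∧ t ≤ x := ht
  simp [Kn, ht', iterKernel]

/-- bounds on the iterated kernels of a Volterra operator and existence of an
inverse kernel `G̃` realising `(I + T_{G̃}) = (I + T_G)⁻¹` with the Gronwall-type bound. -/
theorem volterra_neumann_inverse (A : ℝ) (hA : 0 ≤ A)
    (G : ℝ → ℝ → ℂ) (hGmeas : Measurable (Function.uncurry G))
    (hGbound : ∀ x t : ℝ, 0 < t → t ≤ x → ‖G x t‖ ≤ A * Real.exp (-x)) :
    (∀ n : ℕ, ∀ x t : ℝ, 0 < t → t ≤ x →
      ‖iterKernel G n x t‖ ≤ A ^ (n + 1) / (n.factorial : ℝ) * Real.exp (-x)) ∧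
    ∃ Gt : ℝ → ℝ → ℂ, Measurable (Function.uncurry Gt) ∧
      (∀ x t : ℝ, 0 < t → t ≤ x → ‖Gt x t‖ ≤ A * Real.exp A * Real.exp (-x)) ∧
      ∀ F : ℝ → ℂ, (∀ x : ℝ, 0 ≤ x → IntegrableOn F (Set.Icc 0 x)) →
        (∀ᵐ x ∂(volume.restrict (Set.Ioi (0 : ℝ))),
          applyOp Gt (applyOp G F) x = F x ∧ applyOp G (applyOp Gt F) x = F x) ∧
        (∀ᵐ x ∂(volume.restrict (Set.Ioi (0 : ℝ))),
          ‖F x - applyOp G F x‖ ≤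
            A * Real.exp A * Real.exp (-x) *
              ∫ t in Set.Ioc (0 : ℝ) x, ‖applyOp G F t‖) := by
  refine ⟨fun n x t => iter_bound' A hA G hGbound n x t, Rk G,
    (Rk_VK hA hGmeas hGbound).meas, fun x t _ _ => Rk_bound hA hGbound x t, ?_⟩
  intro F hF0
  have hF : LocInt F := by
    intro x
    rcases le_total 0 x with h | h
    · exact (hF0 x h).mono_set Set.Ioc_subset_Icc_self
    · simp [Set.Ioc_eq_empty (not_lt.2 h)]
  have hK := Kn_VK hA hGmeas hGbound 0
  have hR := Rk_VK hA hGmeas hGbound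
  have hL : ∀ x, applyOp (Rk G) (applyOp G F) x = F x := by
    intro x
    rw [applyOp_Kn G F]
    exact hR.inverse hK (Rk_left hA hGmeas hGbound) hF x
  refine ⟨Filter.Eventually.of_forall fun x => ⟨hL x, ?_⟩, Filter.Eventually.of_forall fun x => ?_⟩
  · rw [applyOp_Kn]
    exact hK.inverse hR (Rk_right hA hGmeas hGbound) hF x
  · have e : F x - applyOp G F x = volterraOp (Rk G) (applyOp G F) x := by
      conv_lhs => rw [← hL x]
      rw [applyOp]; ring
    have hP : IntegrableOn (applyOp G F) (Set.Ioc 0 x) := by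
      have e : applyOp G F = fun s => F s + ∫ t, Kn G 0 s t * F t := by
        funext s; rw [applyOp_Kn, applyOp, hK.volterraOp_eq]
      rw [e]
      exact (hF x).add (hK.locInt_op hF x)
    rw [e, volterraOp, ← integral_const_mul]
    refine norm_integral_le_of_norm_le (hP.norm.const_mul _)
      (Filter.Eventually.of_forall fun t => ?_)
    rw [norm_mul]
    gcongr
    exact Rk_bound hA hGbound x t
end

section
/- Let M ≥ 0 and let τ : (0,∞) → ℂ be measurable with |τ(x)| ≤ M for all x > 0. Let a > 0 and let F, G ∈ L¹((0,a)) satisfy G(x) + ∫₀^x τ(x−t) G(t) dt = F(x) for almost every x ∈ (0,a). Then ∫₀^a |G(t)| dt ≤ e^{aM} ∫₀^a |F(t)| dt. -/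
open MeasureTheory

/-- Gronwall-type `L¹` estimate for the Volterra convolution equation
`G + τ ⋆ G = F` on `(0,a)` with bounded kernel `τ`. -/
theorem volterra_convolution_L1_estimate (M : ℝ) (hM : 0 ≤ M)
    (τ : ℝ → ℂ) (hτm : Measurable τ) (hτ : ∀ x : ℝ, 0 < x → ‖τ x‖ ≤ M)
    (a : ℝ) (ha : 0 < a) (F G : ℝ → ℂ)
    (hF : IntegrableOn F (Set.Ioo 0 a)) (hG : IntegrableOn G (Set.Ioo 0 a))
    (heq : ∀ᵐ x ∂(volume.restrict (Set.Ioo (0 : ℝ) a)),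
      G x + (∫ t in (0 : ℝ)..x, τ (x - t) * G t) = F x) :
    (∫ t in Set.Ioo (0 : ℝ) a, ‖G t‖) ≤
      Real.exp (a * M) * ∫ t in Set.Ioo (0 : ℝ) a, ‖F t‖ := by
  set u : ℝ → ℝ := (Set.Ioo 0 a).indicator (fun t => ‖G t‖) with hu
  set v : ℝ → ℝ := (Set.Ioo 0 a).indicator (fun t => ‖F t‖) with hv
  have hui : Integrable u := (integrable_indicator_iff measurableSet_Ioo).2 hG.norm
  have hvi : Integrable v := (integrable_indicator_iff measurableSet_Ioo).2 hF.norm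
  have hu0 : ∀ t, 0 ≤ u t := fun t => Set.indicator_nonneg (fun _ _ => norm_nonneg _) t
  have hv0 : ∀ t, 0 ≤ v t := fun t => Set.indicator_nonneg (fun _ _ => norm_nonneg _) t
  set g : ℝ → ℝ := fun x => ∫ t in (0 : ℝ)..x, u t with hg
  have hgc : Continuous g :=
    intervalIntegral.continuous_primitive (fun _ _ => hui.intervalIntegrable) 0
  have hg0 : ∀ x, 0 ≤ x → 0 ≤ g x := fun x hx =>
    intervalIntegral.integral_nonneg_of_forall hx hu0
  have hga : g a = ∫ t in Set.Ioo (0 : ℝ) a, ‖G t‖ := by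
    simp only [hg, hu]
    rw [intervalIntegral.integral_of_le ha.le, integral_Ioc_eq_integral_Ioo]
    exact setIntegral_congr_fun measurableSet_Ioo fun t ht => Set.indicator_of_mem ht _
  have hCv : (∫ t, v t) = ∫ t in Set.Ioo (0 : ℝ) a, ‖F t‖ :=
    integral_indicator measurableSet_Ioo
  rw [← hga, ← hCv]
  set C : ℝ := ∫ t, v t with hC
  have hC0 : 0 ≤ C := integral_nonneg hv0
  have hpt : ∀ᵐ x ∂(volume.restrict (Set.Ioo (0 : ℝ) a)), u x ≤ v x + M * g x := by
    filter_upwards [heq, ae_restrict_mem measurableSet_Ioo] with x hx hxm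
    have hb : ‖∫ t in (0 : ℝ)..x, τ (x - t) * G t‖ ≤ M * g x := by
      simp only [hg]
      rw [← intervalIntegral.integral_const_mul]
      rw [intervalIntegral.integral_of_le hxm.1.le, intervalIntegral.integral_of_le hxm.1.le,
        integral_Ioc_eq_integral_Ioo, integral_Ioc_eq_integral_Ioo]
      refine norm_integral_le_of_norm_le (hui.const_mul M).integrableOn ?_
      filter_upwards [ae_restrict_mem measurableSet_Ioo] with t ht
      have htm : t ∈ Set.Ioo 0 a := ⟨ht.1, ht.2.trans hxm.2⟩
      have : u t = ‖G t‖ := Set.indicator_of_mem htm _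
      rw [this, norm_mul]
      exact mul_le_mul_of_nonneg_right (hτ _ (by linarith [ht.2])) (norm_nonneg _)
    have e1 : u x = ‖G x‖ := Set.indicator_of_mem hxm _
    have e2 : v x = ‖F x‖ := Set.indicator_of_mem hxm _
    rw [e1, e2, ← eq_sub_iff_add_eq.2 hx |>.symm]
    exact (norm_sub_le _ _).trans (by linarith)
  set H : ℝ → ℝ := fun x => C + M * ∫ t in (0 : ℝ)..x, g t with hH
  have hgH : ∀ x ∈ Set.Icc 0 a, g x ≤ H x := by
    intro x hx
    have h1 : g x ≤ ∫ t in (0 : ℝ)..x, (v t + M * g t) := by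
      simp only [hg]
      refine intervalIntegral.integral_mono_ae_restrict hx.1 hui.intervalIntegrable
        (hvi.intervalIntegrable.add ((hgc.intervalIntegrable _ _).const_mul M)) ?_
      rw [← restrict_Ioo_eq_restrict_Icc]
      exact ae_restrict_of_ae_restrict_of_subset (Set.Ioo_subset_Ioo_right hx.2) hpt
    rw [intervalIntegral.integral_add hvi.intervalIntegrable
      ((hgc.intervalIntegrable _ _).const_mul M), intervalIntegral.integral_const_mul] at h1
    have h2 : ∫ t in (0 : ℝ)..x, v t ≤ C := by
      rw [intervalIntegral.integral_of_le hx.1]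
      exact setIntegral_le_integral hvi (Filter.Eventually.of_forall hv0)
    simp only [hH]
    linarith
  have hd : ∀ x, HasDerivAt H (M * g x) x := fun x =>
    ((hgc.integral_hasStrictDerivAt 0 x).hasDerivAt.const_mul M).const_add C
  have key := norm_le_gronwallBound_of_norm_deriv_right_le (f := H) (f' := fun x => M * g x)
    (δ := C) (K := M) (ε := 0) (a := 0) (b := a)
    (fun x _ => (hd x).continuousAt.continuousWithinAt)
    (fun x _ => (hd x).hasDerivWithinAt) (by simp [hH, abs_of_nonneg hC0])
    (fun x hx => by
      have h1 := hgH x ⟨hx.1, hx.2.le⟩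
      have h2 := hg0 x hx.1
      rw [Real.norm_of_nonneg (mul_nonneg hM h2), Real.norm_of_nonneg (h2.trans h1), add_zero]
      exact mul_le_mul_of_nonneg_left h1 hM) a ⟨ha.le, le_rfl⟩
  rw [gronwallBound_ε0, sub_zero] at key
  calc g a ≤ H a := hgH a ⟨ha.le, le_rfl⟩
    _ ≤ ‖H a‖ := Real.le_norm_self _
    _ ≤ _ := key
    _ = _ := by rw [mul_comm M a, mul_comm]
end
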